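/- arXiv:1505.01900 — 5 statements merged into one kernel-verified Lean document; each statement's English description precedes it below -/
import Mathlib

section
/- Let a > b > 0 and define sequences by a₁ = a, b₁ = b, a_{n+1} = (a_n + b_n)/2, b_{n+1} = √(a_n(a_n+b_n)/2). Then both sequences converge to a common limit, and this limit equals a / F(1/4, 1/2, 5/4; 1 - b²/a²)², where F is the Gauss hypergeometric function. -/
open Real Filter

/-- Gauss hypergeometric series F(a,b,c;x). -/
noncomputable def hypergeom (a b c x : ℝ) : ℝ :=
  ∑' n : ℕ, ((ascPochhammer ℝ n).eval a * (ascPochhammer ℝ n).eval b) /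
    ((ascPochhammer ℝ n).eval c * (n.factorial : ℝ)) * x ^ n

open MeasureTheory

/-- The binomial series of `(1 - y) ^ (-1/2)`. -/
theorem hasSum_inv_sqrt_one_sub {y : ℝ} (hy : |y| < 1) :
    HasSum (fun n : ℕ => (ascPochhammer ℝ n).eval (1 / 2) / (n.factorial : ℝ) * y ^ n)
      (1 / √(1 - y)) := by
  have h := (Real.one_div_one_sub_rpow_hasFPowerSeriesOnBall_zero (1 / 2)).hasSum
    (y := y) (by simpa [Metric.mem_eball, edist_eq_enorm_sub, enorm_eq_nnnorm,
      ← NNReal.coe_lt_coe] using hy)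
  rw [zero_add, ← Real.sqrt_eq_rpow] at h
  refine h.congr_fun ?_
  intro n
  have hn : (n.factorial : ℝ) ≠ 0 := by positivity
  have hc := Ring.factorial_nsmul_multichoose_eq_ascPochhammer (1 / 2 : ℝ) n
  rw [Ring.multichoose_eq, Polynomial.ascPochhammer_smeval_eq_eval, nsmul_eq_mul] at hc
  rw [FormalMultilinearSeries.ofScalars_apply_eq, ← hc, smul_eq_mul]
  field_simp

theorem ascPochhammer_eval_add_one_mul (x : ℝ) (n : ℕ) :
    (ascPochhammer ℝ n).eval (x + 1) * x = (ascPochhammer ℝ n).eval x * (x + n) := by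
  rw [← ascPochhammer_succ_eval, ascPochhammer_succ_left]
  simp [mul_comm]

/-- The Euler integral `∫₀¹ (1 - x t⁴)^(-1/2) dt`. -/
noncomputable def eulerIntegral (x : ℝ) : ℝ := ∫ t in (0 : ℝ)..1, 1 / √(1 - x * t ^ 4)

theorem hypergeom_eq_eulerIntegral {x : ℝ} (h0 : 0 ≤ x) (h1 : x < 1) :
    hypergeom (1 / 4) (1 / 2) (5 / 4) x = eulerIntegral x := by
  have key := intervalIntegral.hasSum_integral_of_dominated_convergence (μ := volume)
    (a := 0) (b := 1)
    (F := fun (n : ℕ) (t : ℝ) =>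
      (ascPochhammer ℝ n).eval (1 / 2) / (n.factorial : ℝ) * (x * t ^ 4) ^ n)
    (f := fun t => 1 / √(1 - x * t ^ 4))
    (fun n _ => (ascPochhammer ℝ n).eval (1 / 2) / (n.factorial : ℝ) * x ^ n)
    (fun n => (by fun_prop : Continuous _).aestronglyMeasurable) ?_ ?_ ?_ ?_
  · rw [hypergeom, eulerIntegral, ← key.tsum_eq]
    refine tsum_congr fun n => ?_
    have hp := ascPochhammer_eval_add_one_mul (1 / 4) n
    have hq : 0 < (ascPochhammer ℝ n).eval (1 / 4 : ℝ) := ascPochhammer_pos n _ (by norm_num)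
    have hr : 0 < (ascPochhammer ℝ n).eval (5 / 4 : ℝ) := ascPochhammer_pos n _ (by norm_num)
    have hn : (n.factorial : ℝ) ≠ 0 := by positivity
    have hm : (4 * n + 1 : ℝ) ≠ 0 := by positivity
    norm_num at hp
    simp_rw [mul_pow, ← pow_mul]
    rw [intervalIntegral.integral_const_mul, intervalIntegral.integral_const_mul, integral_pow]
    have hfrac : (ascPochhammer ℝ n).eval (1 / 4 : ℝ) / (ascPochhammer ℝ n).eval (5 / 4 : ℝ)
        = 1 / (4 * n + 1) := by
      rw [div_eq_div_iff hr.ne' hm]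
      linarith
    rw [mul_div_mul_comm, hfrac]
    push_cast
    simp
    ring
  · intro n
    refine ae_of_all _ fun t ht => ?_
    rw [Set.uIoc_of_le zero_le_one] at ht
    have hp : 0 < (ascPochhammer ℝ n).eval (1 / 2 : ℝ) := ascPochhammer_pos n _ (by norm_num)
    have ht0 := ht.1.le
    rw [Real.norm_of_nonneg (by positivity)]
    gcongr
    exact mul_le_of_le_one_right h0 (pow_le_one₀ ht0 ht.2)
  · exact ae_of_all _ fun t _ => (hasSum_inv_sqrt_one_sub (by rwa [abs_of_nonneg h0])).summable
  · exact intervalIntegrable_const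
  · refine ae_of_all _ fun t ht => hasSum_inv_sqrt_one_sub ?_
    rw [Set.uIoc_of_le zero_le_one] at ht
    have ht0 := ht.1.le
    rw [abs_of_nonneg (by positivity)]
    exact (mul_le_of_le_one_right h0 (pow_le_one₀ ht0 ht.2)).trans_lt h1

theorem abs_mul_pow_four_le {s u : ℝ} (hu : u ∈ Set.Icc (0 : ℝ) 1) : |s * u ^ 4| ≤ |s| := by
  have := pow_le_one₀ (n := 4) hu.1 hu.2
  rw [abs_mul, abs_of_nonneg (pow_nonneg hu.1 4)]
  exact mul_le_of_le_one_right (abs_nonneg s) this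

/-- Quadratic transformation of the Euler integral, by the substitution
`t = √(1 + s) u / √(1 + s u⁴)`. -/
theorem eulerIntegral_quadratic_transformation {s : ℝ} (hs : |s| < 1) :
    eulerIntegral (4 * s / (1 + s) ^ 2) = √(1 + s) * eulerIntegral (-s) := by
  have hs1 : 0 < 1 + s := by linarith [(abs_lt.1 hs).1]
  set φ : ℝ → ℝ := fun u => √(1 + s) * u / √(1 + s * u ^ 4) with hφ
  set φ' : ℝ → ℝ := fun u => √(1 + s) * (1 - s * u ^ 4) / √(1 + s * u ^ 4) ^ 3 with hφ'
  set g : ℝ → ℝ := fun t => 1 / √(1 - 4 * s / (1 + s) ^ 2 * t ^ 4) with hg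
  have hpos : ∀ u ∈ Set.uIcc (0 : ℝ) 1, 0 < 1 + s * u ^ 4 ∧ 0 < 1 - s * u ^ 4 := by
    intro u hu
    rw [Set.uIcc_of_le zero_le_one] at hu
    have := abs_lt.1 ((abs_mul_pow_four_le (s := s) hu).trans_lt hs)
    constructor <;> linarith [this.1, this.2]
  have hsq : ∀ u ∈ Set.uIcc (0 : ℝ) 1, 1 - 4 * s / (1 + s) ^ 2 * φ u ^ 4 =
      ((1 - s * u ^ 4) / (1 + s * u ^ 4)) ^ 2 := by
    intro u hu
    have h1 : √(1 + s) ^ 4 = (1 + s) ^ 2 := by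
      rw [show 4 = 2 * 2 from rfl, pow_mul, Real.sq_sqrt hs1.le]
    have h2 : √(1 + s * u ^ 4) ^ 4 = (1 + s * u ^ 4) ^ 2 := by
      rw [show √(1 + s * u ^ 4) ^ 4 = (√(1 + s * u ^ 4) ^ 2) ^ 2 by ring,
        Real.sq_sqrt (hpos u hu).1.le]
    have h3 := (hpos u hu).1.ne'
    simp only [hφ, div_pow, mul_pow, h1, h2]
    field_simp
    ring
  have hderiv : ∀ u ∈ Set.uIcc (0 : ℝ) 1, HasDerivAt φ (φ' u) u := by
    intro u hu
    have hp := (hpos u hu).1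
    have hq : 0 < √(1 + s * u ^ 4) := Real.sqrt_pos.2 hp
    have hq2 := Real.sq_sqrt hp.le
    have hin : HasDerivAt (fun u : ℝ => 1 + s * u ^ 4) (s * (4 * u ^ 3)) u := by
      simpa using ((hasDerivAt_pow 4 u).const_mul s).const_add 1
    refine (((hasDerivAt_id u).const_mul √(1 + s)).div (hin.sqrt hp.ne') hq.ne').congr_deriv ?_
    simp only [hφ', id]
    set q := √(1 + s * u ^ 4)
    rw [show 1 - s * u ^ 4 = q ^ 2 - 2 * (s * u ^ 4) by rw [hq2]; ring]
    field_simp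
    ring
  have hφ'c : ContinuousOn φ' (Set.uIcc 0 1) := by
    refine ContinuousOn.div (by fun_prop) (by fun_prop) fun u hu => ?_
    exact pow_ne_zero _ (Real.sqrt_pos.2 (hpos u hu).1).ne'
  have hgc : ContinuousOn g (φ '' Set.uIcc 0 1) := by
    refine ContinuousOn.div (by fun_prop) (by fun_prop) ?_
    rintro _ ⟨u, hu, rfl⟩
    rw [hsq u hu]
    exact (Real.sqrt_pos.2 (pow_pos (div_pos (hpos u hu).2 (hpos u hu).1) 2)).ne'
  have hφ0 : φ 0 = 0 := by simp [hφ]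
  have hφ1 : φ 1 = 1 := by
    simp only [hφ, one_pow, mul_one]
    exact div_self (Real.sqrt_pos.2 hs1).ne'
  have hsubst := intervalIntegral.integral_comp_mul_deriv' hderiv hφ'c hgc
  rw [hφ0, hφ1] at hsubst
  rw [eulerIntegral, eulerIntegral, ← hsubst, ← intervalIntegral.integral_const_mul]
  refine intervalIntegral.integral_congr fun u hu => ?_
  have hp := hpos u hu
  have hq : 0 < √(1 + s * u ^ 4) := Real.sqrt_pos.2 hp.1
  have hq2 := Real.sq_sqrt hp.1.le
  have hne := hp.2.ne'
  simp only [Function.comp, hg, hφ', neg_mul, sub_neg_eq_add]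
  rw [hsq u hu, Real.sqrt_sq (div_pos hp.2 hp.1).le]
  set q := √(1 + s * u ^ 4)
  rw [← hq2]
  field_simp

theorem eulerIntegral_zero : eulerIntegral 0 = 1 := by simp [eulerIntegral]

theorem continuousAt_eulerIntegral_zero : ContinuousAt eulerIntegral 0 := by
  refine intervalIntegral.continuousAt_of_dominated_interval (bound := fun _ => 2) ?_ ?_ ?_ ?_
  · exact Eventually.of_forall fun x =>
      (by fun_prop : Measurable fun t : ℝ => 1 / √(1 - x * t ^ 4)).aestronglyMeasurable
  · filter_upwards [Metric.ball_mem_nhds (0 : ℝ) (by norm_num : (0 : ℝ) < 3 / 4)] with x hx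
    refine ae_of_all _ fun t ht => ?_
    rw [Set.uIoc_of_le zero_le_one] at ht
    rw [Metric.mem_ball, dist_zero_right, Real.norm_eq_abs] at hx
    have h := abs_lt.1 ((abs_mul_pow_four_le (s := x) ⟨ht.1.le, ht.2⟩).trans_lt hx)
    rw [Real.norm_of_nonneg (by positivity), div_le_iff₀ (Real.sqrt_pos.2 (by linarith [h.2]))]
    have : (1 / 2 : ℝ) ≤ √(1 - x * t ^ 4) := Real.le_sqrt_of_sq_le (by linarith [h.2])
    linarith
  · exact intervalIntegrable_const
  · refine ae_of_all _ fun t _ => ContinuousAt.div (by fun_prop) (by fun_prop) ?_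
    simp

theorem eulerIntegral_mean_step {a b : ℝ} (ha : 0 < a) (hb : 0 < b) :
    eulerIntegral (1 - (√(a * (a + b) / 2)) ^ 2 / ((a + b) / 2) ^ 2) / √((a + b) / 2) =
      eulerIntegral (1 - b ^ 2 / a ^ 2) / √a := by
  have hab : 0 < a + b := by positivity
  set s := (a - b) / (a + b) with hs
  have hs1 : 1 + s = a / ((a + b) / 2) := by rw [hs]; field_simp; ring
  have habs : |s| < 1 := by
    rw [hs, abs_lt, lt_div_iff₀ hab, div_lt_iff₀ hab]
    constructor <;> linarith
  have h1 : 1 - b ^ 2 / a ^ 2 = 4 * s / (1 + s) ^ 2 := by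
    rw [hs1, hs]; field_simp; ring
  have h2 : 1 - (√(a * (a + b) / 2)) ^ 2 / ((a + b) / 2) ^ 2 = -s := by
    rw [Real.sq_sqrt (by positivity), hs]; field_simp; ring
  have h3 : 0 < √a := Real.sqrt_pos.2 ha
  rw [h1, h2, eulerIntegral_quadratic_transformation habs, hs1, Real.sqrt_div ha.le]
  field_simp

theorem abs_sqrt_sub_mean_le {a b : ℝ} (ha : 0 < a) (hb : 0 < b) :
    |(a + b) / 2 - √(a * (a + b) / 2)| ≤ |a - b| / 2 := by
  have hsq := Real.sq_sqrt (show 0 ≤ a * (a + b) / 2 by positivity)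
  have h0 := Real.sqrt_nonneg (a * (a + b) / 2)
  set q := √(a * (a + b) / 2)
  have hpos : 0 < (a + b) / 2 + q := by positivity
  have heq : (a + b) / 2 - q = (b - a) * (a + b) / 4 / ((a + b) / 2 + q) := by
    rw [eq_div_iff hpos.ne']
    linarith
  rw [heq, abs_div, abs_of_pos hpos, div_le_iff₀ hpos, abs_div, abs_mul,
    abs_of_pos (show 0 < a + b by positivity), abs_sub_comm b a,
    abs_of_pos (by norm_num : (0 : ℝ) < 4)]
  nlinarith [abs_nonneg (a - b), mul_nonneg (abs_nonneg (a - b)) h0]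

/-- The mean iteration a' = (a+b)/2, b' = √(a(a+b)/2) converges to
a / F(1/4,1/2,5/4; 1-b²/a²)². -/
theorem mean_iteration_limit (a b : ℝ) (hb : 0 < b) (hab : b < a)
    (A B : ℕ → ℝ) (hA0 : A 0 = a) (hB0 : B 0 = b)
    (hA : ∀ n, A (n+1) = (A n + B n) / 2)
    (hB : ∀ n, B (n+1) = Real.sqrt (A n * (A n + B n) / 2)) :
    Tendsto A atTop (nhds (a / hypergeom (1/4) (1/2) (5/4) (1 - b^2/a^2) ^ 2)) ∧
    Tendsto B atTop (nhds (a / hypergeom (1/4) (1/2) (5/4) (1 - b^2/a^2) ^ 2)) := by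
  have hlow : ∀ n, b ≤ A n ∧ b ≤ B n := by
    intro n
    induction n with
    | zero => exact ⟨by rw [hA0]; exact hab.le, hB0.ge⟩
    | succ n ih =>
      refine ⟨by rw [hA]; linarith [ih.1, ih.2], ?_⟩
      rw [hB]
      refine Real.le_sqrt_of_sq_le ?_
      nlinarith [mul_le_mul ih.1 ih.1 hb.le (hb.le.trans ih.1),
        mul_le_mul ih.1 ih.2 hb.le (hb.le.trans ih.1)]
  have hApos : ∀ n, 0 < A n := fun n => hb.trans_le (hlow n).1
  have hBpos : ∀ n, 0 < B n := fun n => hb.trans_le (hlow n).2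
  have hdiff : ∀ n, |A n - B n| ≤ (a - b) / 2 ^ n := by
    intro n
    induction n with
    | zero => simp [hA0, hB0, abs_of_pos (sub_pos.2 hab)]
    | succ n ih =>
      rw [hA, hB, pow_succ, ← div_div]
      exact (abs_sqrt_sub_mean_le (hApos n) (hBpos n)).trans (by linarith)
  have hcauchy : CauchySeq A := by
    refine cauchySeq_of_le_geometric_two (C := a - b) fun n => ?_
    rw [Real.dist_eq, hA, show A n - (A n + B n) / 2 = (A n - B n) / 2 by ring, abs_div, abs_two,
      div_right_comm]
    linarith [hdiff n]
  obtain ⟨L, hL⟩ := cauchySeq_tendsto_of_complete hcauchy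
  have hBL : Tendsto B atTop (nhds L) := by
    have h : Tendsto (fun n => 2 * A (n + 1) - A n) atTop (nhds (2 * L - L)) :=
      ((hL.comp (tendsto_add_atTop_nat 1)).const_mul 2).sub hL
    convert h using 2 with n
    · rw [hA]; ring
    · ring
  have hLpos : 0 < L := hb.trans_le (ge_of_tendsto' hL fun n => (hlow n).1)
  have hinv : ∀ n, eulerIntegral (1 - B n ^ 2 / A n ^ 2) / √(A n) =
      eulerIntegral (1 - b ^ 2 / a ^ 2) / √a := by
    intro n
    induction n with
    | zero => rw [hA0, hB0]
    | succ n ih => rw [hA, hB, eulerIntegral_mean_step (hApos n) (hBpos n), ih]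
  have hratio : Tendsto (fun n => 1 - B n ^ 2 / A n ^ 2) atTop (nhds 0) := by
    have h := ((hBL.pow 2).div (hL.pow 2) (pow_pos hLpos 2).ne').const_sub 1
    rwa [div_self (pow_pos hLpos 2).ne', sub_self] at h
  have hlim : Tendsto (fun n => eulerIntegral (1 - B n ^ 2 / A n ^ 2) / √(A n)) atTop
      (nhds (1 / √L)) := by
    refine Tendsto.div ?_ hL.sqrt (Real.sqrt_pos.2 hLpos).ne'
    simpa only [eulerIntegral_zero, Function.comp_def] using
      continuousAt_eulerIntegral_zero.tendsto.comp hratio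
  simp_rw [hinv] at hlim
  have hval := tendsto_nhds_unique tendsto_const_nhds hlim
  have ha : 0 < a := hb.trans hab
  have hx0 : 0 ≤ 1 - b ^ 2 / a ^ 2 :=
    sub_nonneg.2 ((div_le_one (by positivity)).2 (by gcongr))
  have hx1 : 1 - b ^ 2 / a ^ 2 < 1 := sub_lt_self _ (by positivity)
  have hLeq : a / hypergeom (1 / 4) (1 / 2) (5 / 4) (1 - b ^ 2 / a ^ 2) ^ 2 = L := by
    rw [hypergeom_eq_eulerIntegral hx0 hx1, (div_eq_iff (Real.sqrt_pos.2 ha).ne').1 hval, mul_pow,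
      div_pow, Real.sq_sqrt ha.le, Real.sq_sqrt hLpos.le]
    field_simp
  rw [hLeq]
  exact ⟨hL, hBL⟩
end

section
/- If x satisfies the recursion invariance F(x) = √x · F((2-x)/x applied as b/a-ratio), i.e. for 0 < x < 1 setting a = 1, b = (2-x)/x: then a/F(1/4,1/2,5/4;1-b²/a²)² is invariant under the mean step (a,b) ↦ ((a+b)/2, √(a(a+b)/2)). Precisely: for a > b > 0, a / F(1/4,1/2,5/4; 1-b²/a²)² = a' / F(1/4,1/2,5/4; 1-b'²/a'²)² where a' = (a+b)/2 and b' = √(a(a+b)/2). -/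
open Real

/-- The coefficients of `(1 - x) ^ (-1/2)` lie in `[0, 1]`. -/
theorem ascPochhammer_half_div_factorial_mem_Icc (n : ℕ) :
    (ascPochhammer ℝ n).eval (1 / 2) / n.factorial ∈ Set.Icc (0 : ℝ) 1 := by
  refine ⟨div_nonneg (ascPochhammer_pos n _ (by norm_num)).le (by positivity), ?_⟩
  rw [div_le_one (by positivity)]
  induction n with
  | zero => simp
  | succ k ih =>
    rw [ascPochhammer_succ_eval, Nat.factorial_succ, mul_comm]
    push_cast
    exact mul_le_mul (by linarith) ih (ascPochhammer_pos k _ (by norm_num)).le (by positivity)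

/-- The binomial series of `(1 - x) ^ (-1/2)`. -/
theorem hasSum_one_div_one_sub_rpow_half {x : ℝ} (hx : |x| < 1) :
    HasSum (fun n : ℕ ↦ (ascPochhammer ℝ n).eval (1 / 2) / n.factorial * x ^ n)
      (1 / (1 - x) ^ (1 / 2 : ℝ)) := by
  have h := (Real.one_div_one_sub_rpow_hasFPowerSeriesOnBall_zero (1 / 2)).hasSum
    (y := x) (by simpa [enorm_eq_nnnorm, ← NNReal.coe_lt_coe] using hx)
  rw [zero_add] at h
  convert! h using 1
  funext n
  have hc := Ring.factorial_nsmul_multichoose_eq_ascPochhammer (1 / 2 : ℝ) n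
  rw [Polynomial.ascPochhammer_smeval_eq_eval, Ring.multichoose_eq, nsmul_eq_mul] at hc
  rw [← hc, mul_div_cancel_left₀ _ (by positivity)]
  simp [FormalMultilinearSeries.ofScalars, mul_comm]

theorem ascPochhammer_quarter_div (n : ℕ) :
    (ascPochhammer ℝ n).eval (1 / 4) / (ascPochhammer ℝ n).eval (5 / 4) = 1 / (4 * n + 1) := by
  have hpos := ascPochhammer_pos n (5 / 4 : ℝ) (by norm_num)
  rw [div_eq_div_iff hpos.ne' (by positivity)]
  induction n with
  | zero => simp
  | succ k ih =>
    have ih := ih (ascPochhammer_pos k (5 / 4 : ℝ) (by norm_num))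
    rw [ascPochhammer_succ_eval, ascPochhammer_succ_eval]
    push_cast
    linear_combination (k + 5 / 4 : ℝ) * ih

theorem mul_hypergeom_eq_tsum (e w : ℝ) :
    w * hypergeom (1 / 4) (1 / 2) (5 / 4) (e * w ^ 4) =
      ∑' n : ℕ, (ascPochhammer ℝ n).eval (1 / 2) / n.factorial * e ^ n *
        (w ^ (4 * n + 1) / (4 * n + 1)) := by
  rw [hypergeom, ← tsum_mul_left]
  refine tsum_congr fun n ↦ ?_
  have h := ascPochhammer_quarter_div n
  rw [mul_div_mul_comm, h]
  ring

/-- `w F(1/4, 1/2; 5/4; e w⁴)` is a primitive of `(1 - e w⁴) ^ (-1/2)`. -/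
theorem hasDerivAt_mul_hypergeom {e w : ℝ} (he : |e| ≤ 1) (hw : |w| < 1) :
    HasDerivAt (fun v ↦ v * hypergeom (1 / 4) (1 / 2) (5 / 4) (e * v ^ 4))
      (1 / (1 - e * w ^ 4) ^ (1 / 2 : ℝ)) w := by
  simp_rw [mul_hypergeom_eq_tsum]
  obtain ⟨r, hwr, hr⟩ := exists_between hw
  have hr0 : 0 ≤ r := (abs_nonneg w).trans hwr.le
  have hew : |e * w ^ 4| < 1 := by
    rw [abs_mul, abs_pow]
    exact (mul_le_of_le_one_left (by positivity) he).trans_lt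
      (pow_lt_one₀ (abs_nonneg w) hw (by norm_num))
  rw [← (hasSum_one_div_one_sub_rpow_half hew).tsum_eq]
  have key := hasDerivAt_tsum_of_isPreconnected (𝕜 := ℝ)
    (g := fun (n : ℕ) v ↦ (ascPochhammer ℝ n).eval (1 / 2) / n.factorial * e ^ n *
        (v ^ (4 * n + 1) / (4 * n + 1)))
    (g' := fun n v ↦ (ascPochhammer ℝ n).eval (1 / 2) / n.factorial * (e * v ^ 4) ^ n)
    (u := fun n ↦ (r ^ 4) ^ n) (t := Set.Ioo (-r) r) (y₀ := 0) (y := w)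
    (summable_geometric_of_lt_one (by positivity) (pow_lt_one₀ hr0 hr (by norm_num)))
    isOpen_Ioo isPreconnected_Ioo ?_ ?_ ?_ ?_ (abs_lt.mp hwr)
  · exact key
  · intro n v _
    convert! (((hasDerivAt_pow (4 * n + 1) v).div_const (4 * n + 1 : ℝ)).const_mul
      ((ascPochhammer ℝ n).eval (1 / 2) / n.factorial * e ^ n)) using 1
    have : (4 * n + 1 : ℝ) ≠ 0 := by positivity
    push_cast
    rw [mul_div_cancel_left₀ _ this, mul_pow, ← pow_mul]
    ring
  · intro n v hv
    obtain ⟨h0, h1⟩ := ascPochhammer_half_div_factorial_mem_Icc n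
    rw [Real.norm_eq_abs, abs_mul, abs_of_nonneg h0, abs_pow, abs_mul, abs_pow]
    refine (mul_le_of_le_one_left (by positivity) h1).trans ?_
    gcongr
    exact (mul_le_of_le_one_left (by positivity) he).trans
      (pow_le_pow_left₀ (abs_nonneg v) (abs_lt.mpr hv).le 4)
  · have := abs_nonneg w
    constructor <;> linarith
  · simp

/-- The lemniscatic substitution `r ↦ √2 r / √(1 + r⁴)`. -/
theorem hasDerivAt_lemniscatic_substitution (r : ℝ) :
    HasDerivAt (fun r : ℝ ↦ √2 * r / √(1 + r ^ 4))
      (√2 * ((1 - r ^ 4) / (1 + r ^ 4)) / √(1 + r ^ 4)) r := by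
  have hp : 0 < 1 + r ^ 4 := by positivity
  have hs := Real.sqrt_pos.mpr hp
  have hd : HasDerivAt (fun r : ℝ ↦ 1 + r ^ 4) (4 * r ^ 3) r := by
    simpa using (hasDerivAt_pow 4 r).const_add 1
  convert! ((hasDerivAt_id r).const_mul √2).div (hd.sqrt hp.ne') hs.ne' using 1
  have hsq := Real.sq_sqrt hp.le
  rw [hsq]
  simp only [id]
  field_simp
  rw [hsq]
  ring

theorem lemniscatic_substitution_pow_four (r : ℝ) :
    (√2 * r / √(1 + r ^ 4)) ^ 4 = 4 * r ^ 4 / (1 + r ^ 4) ^ 2 := by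
  have hp : 0 ≤ 1 + r ^ 4 := by positivity
  rw [div_pow, mul_pow, show √2 ^ 4 = (√2 ^ 2) ^ 2 by ring,
    show √(1 + r ^ 4) ^ 4 = (√(1 + r ^ 4) ^ 2) ^ 2 by ring, Real.sq_sqrt hp,
    Real.sq_sqrt (by norm_num)]
  norm_num

theorem lemniscatic_hypergeom_eq {r : ℝ} (hr : r ∈ Set.Ioo (-1 : ℝ) 1) :
    √2 * r / √(1 + r ^ 4) *
        hypergeom (1 / 4) (1 / 2) (5 / 4) (1 * (√2 * r / √(1 + r ^ 4)) ^ 4) =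
      √2 * (r * hypergeom (1 / 4) (1 / 2) (5 / 4) (-1 * r ^ 4)) := by
  have hf (s : ℝ) (hs : s ∈ Set.Ioo (-1 : ℝ) 1) :
      HasDerivAt (fun s ↦ √2 * s / √(1 + s ^ 4) *
        hypergeom (1 / 4) (1 / 2) (5 / 4) (1 * (√2 * s / √(1 + s ^ 4)) ^ 4))
        (√2 * (1 / (1 - -1 * s ^ 4) ^ (1 / 2 : ℝ))) s := by
    have hs4 : s ^ 4 < 1 := by
      rw [← Even.pow_abs (by decide : Even 4)]
      exact pow_lt_one₀ (abs_nonneg s) (abs_lt.mpr hs) (by norm_num)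
    have hp : 0 < 1 + s ^ 4 := by positivity
    have hsub : 1 - 1 * (√2 * s / √(1 + s ^ 4)) ^ 4 = ((1 - s ^ 4) / (1 + s ^ 4)) ^ 2 := by
      rw [lemniscatic_substitution_pow_four]
      field_simp
      ring
    have hm : 1 - s ^ 4 ≠ 0 := (sub_pos.mpr hs4).ne'
    have hpos : 0 < (1 - s ^ 4) / (1 + s ^ 4) := div_pos (by linarith) hp
    have hlt : |√2 * s / √(1 + s ^ 4)| < 1 := by
      refine (pow_lt_one_iff_of_nonneg (abs_nonneg _) (n := 4) (by norm_num)).mp ?_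
      rw [Even.pow_abs (by decide)]
      nlinarith
    convert! (hasDerivAt_mul_hypergeom (e := 1) (by simp) hlt).comp s
      (hasDerivAt_lemniscatic_substitution s) using 1
    rw [hsub, ← Real.sqrt_eq_rpow, ← Real.sqrt_eq_rpow, Real.sqrt_sq hpos.le,
      show 1 - -1 * s ^ 4 = 1 + s ^ 4 by ring]
    field_simp
  have hg (s : ℝ) (hs : s ∈ Set.Ioo (-1 : ℝ) 1) :=
    (hasDerivAt_mul_hypergeom (e := -1) (by simp) (abs_lt.mpr hs)).const_mul √2
  exact isOpen_Ioo.eqOn_of_deriv_eq isPreconnected_Ioo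
    (fun s hs ↦ (hf s hs).differentiableAt.differentiableWithinAt)
    (fun s hs ↦ (hg s hs).differentiableAt.differentiableWithinAt)
    (fun s hs ↦ (hf s hs).deriv.trans (hg s hs).deriv.symm)
    (x := 0) (by simp) (by simp) hr

/-- The quadratic transformation `F(4u / (1 + u)²) = √(1 + u) F(-u)`, squared. -/
theorem hypergeom_sq_quadratic_transformation {u : ℝ} (hu0 : 0 < u) (hu1 : u < 1) :
    hypergeom (1 / 4) (1 / 2) (5 / 4) (4 * u / (1 + u) ^ 2) ^ 2 =
      (1 + u) * hypergeom (1 / 4) (1 / 2) (5 / 4) (-u) ^ 2 := by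
  have hr4 : √√u ^ 4 = u := by
    rw [show √√u ^ 4 = (√√u ^ 2) ^ 2 by ring, Real.sq_sqrt (Real.sqrt_nonneg u),
      Real.sq_sqrt hu0.le]
  have hr0 : 0 < √√u := Real.sqrt_pos.mpr (Real.sqrt_pos.mpr hu0)
  have hr1 : √√u < 1 := by
    rw [Real.sqrt_lt' one_pos, Real.sqrt_lt' (by norm_num)]
    simpa using hu1
  have h := lemniscatic_hypergeom_eq (r := √√u) ⟨by linarith, hr1⟩
  rw [lemniscatic_substitution_pow_four, hr4, one_mul, neg_one_mul] at h
  have hs : 0 < √(1 + u) := Real.sqrt_pos.mpr (by linarith)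
  have h2 : 0 < √2 := by positivity
  have h' : hypergeom (1 / 4) (1 / 2) (5 / 4) (4 * u / (1 + u) ^ 2) =
      √(1 + u) * hypergeom (1 / 4) (1 / 2) (5 / 4) (-u) := by
    refine mul_left_cancel₀ (div_pos (mul_pos h2 hr0) hs).ne' (h.trans ?_)
    field_simp
  rw [h', mul_pow, Real.sq_sqrt (by linarith)]

/-- a / F(1/4,1/2,5/4; 1-b²/a²)² is invariant under the mean step
(a,b) ↦ ((a+b)/2, √(a(a+b)/2)). -/
theorem mean_step_invariant (a b : ℝ) (hb : 0 < b) (hab : b < a) :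
    a / hypergeom (1/4) (1/2) (5/4) (1 - b^2/a^2) ^ 2 =
      ((a + b)/2) / hypergeom (1/4) (1/2) (5/4)
        (1 - (Real.sqrt (a * (a + b) / 2))^2 / ((a + b)/2)^2) ^ 2 := by
  have ha : 0 < a := hb.trans hab
  have hs : 0 < a + b := by linarith
  have h := hypergeom_sq_quadratic_transformation (u := (a - b) / (a + b))
    (div_pos (by linarith) hs) (by rw [div_lt_one hs]; linarith)
  have hu : 1 + (a - b) / (a + b) = 2 * a / (a + b) := by
    field_simp
    ring
  have hz : 4 * ((a - b) / (a + b)) / (2 * a / (a + b)) ^ 2 = 1 - b ^ 2 / a ^ 2 := by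
    field_simp
    ring
  have hz' : 1 - √(a * (a + b) / 2) ^ 2 / ((a + b) / 2) ^ 2 = -((a - b) / (a + b)) := by
    rw [Real.sq_sqrt (by positivity)]
    field_simp
    ring
  rw [hu, hz] at h
  rw [hz', h, ← div_div]
  congr 1
  field_simp
end

section
/- θ_{0,0}(0, i) = Γ(1/4) / (4π³)^{1/4}. -/
open Complex Real

/-- Theta function with characteristics a, b:
θ_{a,b}(z,τ) = Σ_{n∈ℤ} exp(πi(n+a)²τ + 2πi(n+a)(z+b)). -/
noncomputable def theta (a b : ℝ) (z τ : ℂ) : ℂ :=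
  ∑' n : ℤ, Complex.exp (Real.pi * Complex.I * ((n : ℂ) + (a : ℂ))^2 * τ +
    2 * Real.pi * Complex.I * ((n : ℂ) + (a : ℂ)) * (z + (b : ℂ)))

/-- The theta constant `θ_{0,0}(0, it)` as a real series. -/
noncomputable def realTheta (t : ℝ) : ℝ := ∑' n : ℤ, Real.exp (-(Real.pi * t * (n : ℝ) ^ 2))

/-- The series `∑ exp(-πt(2n+1)²)` over odd integers. -/
noncomputable def oddTheta (t : ℝ) : ℝ :=
  ∑' n : ℤ, Real.exp (-(Real.pi * t * (2 * (n : ℝ) + 1) ^ 2))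

lemma theta_zero_eq_jacobiTheta (τ : ℂ) : theta 0 0 0 τ = jacobiTheta τ := by
  simp [theta, jacobiTheta]

lemma ofReal_realTheta (t : ℝ) : (realTheta t : ℂ) = jacobiTheta (t * Complex.I) := by
  rw [realTheta, jacobiTheta, Complex.ofReal_tsum]
  refine tsum_congr fun n => ?_
  push_cast
  congr 1
  linear_combination (-(Real.pi : ℂ) * t * n ^ 2) * Complex.I_mul_I

lemma summable_realTheta {t : ℝ} (ht : 0 < t) :
    Summable fun n : ℤ => Real.exp (-(Real.pi * t * (n : ℝ) ^ 2)) := by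
  have h := (hasSum_jacobiTheta₂_term 0 (τ := t * Complex.I) (by simpa using ht)).summable.norm
  refine h.congr fun n => ?_
  rw [norm_jacobiTheta₂_term]
  simp
  ring

lemma summable_oddTheta {t : ℝ} (ht : 0 < t) :
    Summable fun n : ℤ => Real.exp (-(Real.pi * t * (2 * (n : ℝ) + 1) ^ 2)) := by
  have h := (summable_realTheta ht).comp_injective
    (i := fun n : ℤ => 2 * n + 1) (fun a b h => by simpa using h)
  simpa [Function.comp_def] using h

lemma realTheta_pos {t : ℝ} (ht : 0 < t) : 0 < realTheta t :=
  (summable_realTheta ht).tsum_pos (fun _ => (Real.exp_pos _).le) 0 (Real.exp_pos _)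

/-- A sum over the disjoint union of the images of two injective maps. -/
lemma hasSum_of_isCompl_range {α β γ : Type*} {f : γ → ℝ} {i : α → γ} {j : β → γ} {a b : ℝ}
    (hi : Function.Injective i) (hj : Function.Injective j)
    (h : IsCompl (Set.range i) (Set.range j))
    (ha : HasSum (fun x => f (i x)) a) (hb : HasSum (fun x => f (j x)) b) :
    HasSum f (a + b) :=
  (hi.hasSum_range_iff.2 ha).add_isCompl h (hj.hasSum_range_iff.2 hb)

lemma realTheta_eq_add_oddTheta {t : ℝ} (ht : 0 < t) :
    realTheta t = realTheta (4 * t) + oddTheta t := by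
  refine (hasSum_of_isCompl_range (i := fun n : ℤ => 2 * n) (j := fun n : ℤ => 2 * n + 1)
    (fun a b h => by simpa using h) (fun a b h => by simpa using h) ?_ ?_ ?_).tsum_eq
  · simpa [Set.ext_iff, Function.comp_def] using Int.isCompl_even_odd
  · have h : HasSum _ (realTheta (4 * t)) := (summable_realTheta (by positivity)).hasSum
    convert h using 3 with n
    push_cast
    ring
  · have h : HasSum _ (oddTheta t) := (summable_oddTheta ht).hasSum
    simpa using h

lemma HasSum.mul_of_nonneg {α β : Type*} {f : α → ℝ} {g : β → ℝ} {a b : ℝ}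
    (hf : HasSum f a) (hg : HasSum g b) (hf' : ∀ x, 0 ≤ f x) (hg' : ∀ x, 0 ≤ g x) :
    HasSum (fun p : α × β => f p.1 * g p.2) (a * b) :=
  hf.mul hg (hf.summable.mul_of_nonneg hg.summable hf' hg')

/-- Sorting the pairs `(a, b)` by the parity of `a + b`. -/
lemma realTheta_two_mul_sq {t : ℝ} (ht : 0 < t) :
    realTheta (2 * t) ^ 2 = realTheta (4 * t) ^ 2 + oddTheta t ^ 2 := by
  have hF : ∀ {s : ℝ}, 0 < s → HasSum _ (realTheta s) := fun hs => (summable_realTheta hs).hasSum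
  have hO : HasSum _ (oddTheta t) := (summable_oddTheta ht).hasSum
  have h2 := (hF (s := 2 * t) (by positivity)).mul_of_nonneg (hF (s := 2 * t) (by positivity))
    (fun _ => (Real.exp_pos _).le) (fun _ => (Real.exp_pos _).le)
  have h4 := (hF (s := 4 * t) (by positivity)).mul_of_nonneg (hF (s := 4 * t) (by positivity))
    (fun _ => (Real.exp_pos _).le) (fun _ => (Real.exp_pos _).le)
  have ho := hO.mul_of_nonneg hO (fun _ => (Real.exp_pos _).le) (fun _ => (Real.exp_pos _).le)
  simp only [← Real.exp_add] at h2 h4 ho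
  rw [sq, sq, sq]
  refine h2.unique (hasSum_of_isCompl_range
    (i := fun p : ℤ × ℤ => (p.1 + p.2, p.1 - p.2))
    (j := fun p : ℤ × ℤ => (p.1 + p.2 + 1, p.1 - p.2)) ?_ ?_ ?_ ?_ ?_)
  · rintro ⟨a, b⟩ ⟨c, d⟩ h
    simp only [Prod.mk.injEq] at h ⊢
    omega
  · rintro ⟨a, b⟩ ⟨c, d⟩ h
    simp only [Prod.mk.injEq] at h ⊢
    omega
  · rw [isCompl_comm, ← eq_compl_iff_isCompl, eq_comm]
    ext ⟨a, b⟩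
    simp only [Set.mem_compl_iff, Set.mem_range, Prod.exists, Prod.mk.injEq]
    constructor
    · intro h
      by_contra h'
      rcases Int.even_or_odd' (a + b) with ⟨k, hk | hk⟩
      · exact h ⟨k, a - k, by omega, by omega⟩
      · exact h' ⟨k, a - 1 - k, by omega, by omega⟩
    · rintro ⟨c, d, h1, h2⟩ ⟨e, f, h3, h4⟩
      omega
  · convert h4 using 3 with p
    push_cast
    ring
  · convert ho using 3 with p
    push_cast
    ring

/-- The constant `θ_{0,1/2}(0, it)`, written through `θ_{0,0}`. -/
noncomputable def altTheta (t : ℝ) : ℝ := 2 * realTheta (4 * t) - realTheta t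

lemma realTheta_sq_add_altTheta_sq {t : ℝ} (ht : 0 < t) :
    realTheta t ^ 2 + altTheta t ^ 2 = 2 * realTheta (2 * t) ^ 2 := by
  rw [realTheta_two_mul_sq ht, altTheta, realTheta_eq_add_oddTheta ht]
  ring

lemma realTheta_mul_altTheta {t : ℝ} (ht : 0 < t) :
    realTheta t * altTheta t = altTheta (2 * t) ^ 2 := by
  have h1 := realTheta_sq_add_altTheta_sq ht
  have h2 := realTheta_sq_add_altTheta_sq (t := 2 * t) (by positivity)
  have h3 : 2 * realTheta (2 * (2 * t)) = realTheta t + altTheta t := by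
    rw [altTheta]
    ring_nf
  linear_combination -(1 / 2) * h1 - h2 -
    (1 / 2) * (2 * realTheta (2 * (2 * t)) + realTheta t + altTheta t) * h3

lemma realTheta_half : realTheta (1 / 2) = √2 * realTheta 2 := by
  have h := Real.tsum_exp_neg_mul_int_sq (a := 1 / 2) (by norm_num)
  rw [← Real.sqrt_eq_rpow, one_div (2 : ℝ), Real.sqrt_inv, one_div, inv_inv] at h
  have h1 : -Real.pi / 2⁻¹ = -(Real.pi * 2) := by ring
  simpa [realTheta, h1, neg_mul] using h

lemma tendsto_realTheta : Filter.Tendsto realTheta Filter.atTop (nhds 1) := by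
  rw [← tendsto_sub_nhds_zero_iff]
  have he : Filter.Tendsto (fun t : ℝ => Real.exp (-Real.pi * t)) Filter.atTop (nhds 0) :=
    Real.tendsto_exp_atBot.comp
      (Filter.tendsto_id.const_mul_atTop_of_neg (neg_lt_zero.2 Real.pi_pos))
  have hb : Filter.Tendsto
      (fun t : ℝ => 2 / (1 - Real.exp (-Real.pi * t)) * Real.exp (-Real.pi * t))
      Filter.atTop (nhds (2 / (1 - 0) * 0)) :=
    (tendsto_const_nhds.div (tendsto_const_nhds.sub he) (by norm_num)).mul he
  rw [mul_zero] at hb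
  refine squeeze_zero_norm' ?_ hb
  filter_upwards [Filter.eventually_gt_atTop 0] with t ht
  have h := norm_jacobiTheta_sub_one_le (τ := t * Complex.I) (by simpa using ht)
  rw [← ofReal_realTheta, ← Complex.ofReal_one, ← Complex.ofReal_sub, Complex.norm_real] at h
  simpa using h

lemma tendsto_altTheta : Filter.Tendsto altTheta Filter.atTop (nhds 1) := by
  have h := (tendsto_realTheta.comp
    (Filter.tendsto_id.const_mul_atTop (zero_lt_four' ℝ))).const_mul 2 |>.sub tendsto_realTheta
  norm_num at h
  exact h

open MeasureTheory Set

/-- The complete elliptic integral `∫ dt / √((t² + c)(t² + p))` over the real line. -/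
noncomputable def ellipticIntegral (c p : ℝ) : ℝ := ∫ t : ℝ, (√((t ^ 2 + c) * (t ^ 2 + p)))⁻¹

/-- The Gauss substitution `t = (x - p / x) / 2`. -/
lemma ellipticIntegral_eq_integral_Ioi {c p : ℝ} (hp : 0 < p) :
    ellipticIntegral c p =
      2 * ∫ x in Ioi (0 : ℝ), (√(x ^ 4 + (4 * c - 2 * p) * x ^ 2 + p ^ 2))⁻¹ := by
  have himage : (fun x : ℝ => (x - p / x) / 2) '' Ioi 0 = univ := by
    refine eq_univ_of_forall fun t => ⟨t + √(t ^ 2 + p), ?_, ?_⟩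
    · have : |t| < √(t ^ 2 + p) := by
        rw [← Real.sqrt_sq_eq_abs]
        exact Real.sqrt_lt_sqrt (sq_nonneg t) (by linarith)
      have := neg_abs_le t
      simp only [mem_Ioi]
      linarith
    · have h : |t| < √(t ^ 2 + p) := by
        rw [← Real.sqrt_sq_eq_abs]
        exact Real.sqrt_lt_sqrt (sq_nonneg t) (by linarith)
      have h' : 0 < t + √(t ^ 2 + p) := by
        have := neg_abs_le t
        linarith
      have hs : √(t ^ 2 + p) ^ 2 = t ^ 2 + p := Real.sq_sqrt (by positivity)
      simp only
      field_simp
      linear_combination hs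
  have hderiv : ∀ x ∈ Ioi (0 : ℝ), HasDerivWithinAt (fun x : ℝ => (x - p / x) / 2)
      ((1 + p / x ^ 2) / 2) (Ioi 0) x := by
    intro x hx
    have hx : x ≠ 0 := (mem_Ioi.1 hx).ne'
    have h := (((hasDerivAt_id x).sub ((hasDerivAt_inv hx).const_mul p)).div_const 2)
    refine (h.congr_deriv ?_).hasDerivWithinAt
    field_simp
    ring
  have hinj : InjOn (fun x : ℝ => (x - p / x) / 2) (Ioi 0) := by
    intro x hx y hy h
    have hx : 0 < x := hx
    have hy : 0 < y := hy
    simp only at h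
    field_simp at h
    have h0 : (x - y) * (x * y + p) = 0 := by linear_combination h
    rcases mul_eq_zero.1 h0 with h1 | h1
    · linarith
    · have : 0 < x * y + p := by positivity
      linarith
  rw [ellipticIntegral, ← setIntegral_univ, ← himage,
    integral_image_eq_integral_abs_deriv_smul measurableSet_Ioi hderiv hinj,
    ← integral_const_mul]
  refine setIntegral_congr_fun measurableSet_Ioi fun x hx => ?_
  have hx : 0 < x := hx
  have hq : ((((x - p / x) / 2) ^ 2 + c) * (((x - p / x) / 2) ^ 2 + p)) =
      ((x ^ 2 + p) / (4 * x ^ 2)) ^ 2 * (x ^ 4 + (4 * c - 2 * p) * x ^ 2 + p ^ 2) := by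
    field_simp
    ring
  simp only [smul_eq_mul]
  rw [hq, Real.sqrt_mul (sq_nonneg _), Real.sqrt_sq (by positivity), mul_inv,
    abs_of_pos (by positivity), ← mul_assoc]
  congr 1
  field_simp
  norm_num

/-- Invariance of the elliptic integral under the arithmetic-geometric mean step. -/
lemma ellipticIntegral_mean {a b : ℝ} (ha : 0 < a) (hb : 0 < b) :
    ellipticIntegral (((a + b) / 2) ^ 2) (a * b) = ellipticIntegral (a ^ 2) (b ^ 2) := by
  rw [ellipticIntegral_eq_integral_Ioi (by positivity), ellipticIntegral]
  have h := integral_comp_abs (f := fun t : ℝ => (√((t ^ 2 + a ^ 2) * (t ^ 2 + b ^ 2)))⁻¹)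
  simp only [sq_abs] at h
  rw [h]
  congr! 5
  ring

lemma ellipticIntegral_smul {r : ℝ} (hr : 0 < r) (c p : ℝ) :
    ellipticIntegral (r ^ 2 * c) (r ^ 2 * p) = r⁻¹ * ellipticIntegral c p := by
  have h := Measure.integral_comp_mul_left
    (fun t : ℝ => (√((t ^ 2 + r ^ 2 * c) * (t ^ 2 + r ^ 2 * p)))⁻¹) r
  rw [abs_of_pos (inv_pos.2 hr), smul_eq_mul] at h
  have h2 : ∀ t : ℝ, (√(((r * t) ^ 2 + r ^ 2 * c) * ((r * t) ^ 2 + r ^ 2 * p)))⁻¹ =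
      (r ^ 2)⁻¹ * (√((t ^ 2 + c) * (t ^ 2 + p)))⁻¹ := by
    intro t
    rw [show ((r * t) ^ 2 + r ^ 2 * c) * ((r * t) ^ 2 + r ^ 2 * p) =
      (r ^ 2) ^ 2 * ((t ^ 2 + c) * (t ^ 2 + p)) by ring, Real.sqrt_mul (sq_nonneg _),
      Real.sqrt_sq (by positivity), mul_inv]
  simp only [h2, integral_const_mul] at h
  simp only [ellipticIntegral]
  field_simp at h ⊢
  linarith

lemma ellipticIntegral_one_one : ellipticIntegral 1 1 = Real.pi := by
  rw [ellipticIntegral, ← integral_univ_inv_one_add_sq]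
  congr! 2 with t
  rw [← sq, Real.sqrt_sq (by positivity), add_comm]

lemma tendsto_ellipticIntegral {c p : ℕ → ℝ}
    (hc : Filter.Tendsto c Filter.atTop (nhds 1)) (hp : Filter.Tendsto p Filter.atTop (nhds 1)) :
    Filter.Tendsto (fun n => ellipticIntegral (c n) (p n)) Filter.atTop (nhds Real.pi) := by
  rw [← ellipticIntegral_one_one]
  refine tendsto_integral_filter_of_dominated_convergence (fun t => 2 * (1 + t ^ 2)⁻¹) ?_ ?_
    (integrable_inv_one_add_sq.const_mul 2) ?_
  · exact Filter.Eventually.of_forall fun n => by fun_prop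
  · filter_upwards [hc.eventually (lt_mem_nhds (show (1 / 2 : ℝ) < 1 by norm_num)),
      hp.eventually (lt_mem_nhds (show (1 / 2 : ℝ) < 1 by norm_num))] with n hcn hpn
    refine Filter.Eventually.of_forall fun t => ?_
    have ht := sq_nonneg t
    rw [Real.norm_of_nonneg (by positivity),
      show 2 * (1 + t ^ 2)⁻¹ = ((1 + t ^ 2) / 2)⁻¹ by field_simp]
    refine inv_anti₀ (by positivity) (Real.le_sqrt_of_sq_le ?_)
    rw [sq]
    gcongr <;> linarith
  · refine Filter.Eventually.of_forall fun t => ?_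
    refine Filter.Tendsto.inv₀ ?_ (by positivity)
    exact ((hc.const_add _).mul (hp.const_add _)).sqrt

lemma integral_exp_neg_mul_pow_four {s : ℝ} (hs : 0 < s) :
    ∫ x in Ioi (0 : ℝ), Real.exp (-(s * x ^ 4)) =
      s ^ (-(1 / 4) : ℝ) * (Real.Gamma (1 / 4) / 4) := by
  have h := _root_.integral_exp_neg_mul_rpow (p := 4) (by norm_num) hs
  rw [Real.Gamma_add_one (by norm_num)] at h
  convert h using 1
  · congr! 3 with x
    norm_num
  · congr! 1
    · norm_num
    · ring

lemma inv_sqrt_eq_integral {y : ℝ} (hy : 0 < y) :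
    (√y)⁻¹ = (√Real.pi)⁻¹ *
      ∫ s in Ioi (0 : ℝ), s ^ (-(1 / 2) : ℝ) * Real.exp (-(y * s)) := by
  have h := Real.integral_rpow_mul_exp_neg_mul_Ioi (a := 1 / 2) (by norm_num) hy
  rw [Real.Gamma_one_half_eq, ← Real.sqrt_eq_rpow, one_div y, Real.sqrt_inv] at h
  norm_num at h ⊢
  rw [h]
  have := Real.pi_pos
  field_simp

lemma integral_inv_sqrt_pow_four_add_four :
    ∫ x in Ioi (0 : ℝ), (√(x ^ 4 + 4))⁻¹ =
      Real.Gamma (1 / 4) ^ 2 / (4 * √2 * √Real.pi) := by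
  have hinner : ∀ s ∈ Ioi (0 : ℝ),
      ∫ x in Ioi (0 : ℝ), s ^ (-(1 / 2) : ℝ) * Real.exp (-((x ^ 4 + 4) * s)) =
        (Real.Gamma (1 / 4) / 4) * (s ^ ((1 / 4 : ℝ) - 1) * Real.exp (-(4 * s))) := by
    intro s hs
    have hs : 0 < s := hs
    have h1 : ∀ x : ℝ, s ^ (-(1 / 2) : ℝ) * Real.exp (-((x ^ 4 + 4) * s)) =
        s ^ (-(1 / 2) : ℝ) * Real.exp (-(4 * s)) * Real.exp (-(s * x ^ 4)) := by
      intro x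
      rw [mul_assoc, ← Real.exp_add]
      ring_nf
    simp only [h1]
    rw [integral_const_mul, integral_exp_neg_mul_pow_four hs,
      show (1 / 4 : ℝ) - 1 = -(1 / 2) + -(1 / 4) by norm_num, Real.rpow_add hs]
    ring
  have hG : 0 < Real.Gamma (1 / 4) := Real.Gamma_pos_of_pos (by norm_num)
  have houter := Real.integral_rpow_mul_exp_neg_mul_Ioi (a := 1 / 4) (r := 4)
    (by norm_num) (by norm_num)
  have hint : Integrable (Function.uncurry fun x s : ℝ =>
      s ^ (-(1 / 2) : ℝ) * Real.exp (-((x ^ 4 + 4) * s)))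
      ((volume.restrict (Ioi 0)).prod (volume.restrict (Ioi 0))) := by
    rw [integrable_prod_iff' (by
      simp only [Function.uncurry_def]
      exact Measurable.aestronglyMeasurable (by fun_prop))]
    constructor
    · filter_upwards [ae_restrict_mem measurableSet_Ioi] with s hs
      refine Integrable.of_integral_ne_zero ?_
      simp only [Function.uncurry_apply_pair]
      rw [hinner s hs]
      have hs : 0 < s := hs
      positivity
    · have h2 : Integrable (fun s : ℝ => (Real.Gamma (1 / 4) / 4) *
          (s ^ ((1 / 4 : ℝ) - 1) * Real.exp (-(4 * s)))) (volume.restrict (Ioi 0)) := by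
        refine Integrable.const_mul (Integrable.of_integral_ne_zero ?_) _
        rw [houter]
        positivity
      refine h2.congr ?_
      filter_upwards [ae_restrict_mem measurableSet_Ioi] with s hs
      rw [← hinner s hs]
      congr! 2 with x
      have hs : 0 < s := hs
      exact (Real.norm_of_nonneg (by positivity)).symm
  have hswap := integral_integral_swap hint
  rw [setIntegral_congr_fun measurableSet_Ioi hinner, integral_const_mul, houter] at hswap
  have h4 : (1 / 4 : ℝ) ^ (1 / 4 : ℝ) = (√2)⁻¹ := by
    rw [show (1 / 4 : ℝ) ^ (1 / 4 : ℝ) = ((1 / 2 : ℝ) ^ (2 : ℝ)) ^ (1 / 4 : ℝ) by norm_num,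
      ← Real.rpow_mul (by norm_num), ← Real.sqrt_inv, Real.sqrt_eq_rpow]
    norm_num
  have h5 : ∀ x : ℝ, (√(x ^ 4 + 4))⁻¹ = (√Real.pi)⁻¹ *
      ∫ s in Ioi (0 : ℝ), s ^ (-(1 / 2) : ℝ) * Real.exp (-((x ^ 4 + 4) * s)) :=
    fun x => inv_sqrt_eq_integral (by positivity)
  simp only [h5]
  rw [integral_const_mul, hswap, h4]
  field_simp

lemma ellipticIntegral_one_two :
    ellipticIntegral 1 2 = Real.Gamma (1 / 4) ^ 2 / (2 * √2 * √Real.pi) := by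
  have h := ellipticIntegral_eq_integral_Ioi (c := 1) (p := 2) (by norm_num)
  norm_num at h
  rw [h, integral_inv_sqrt_pow_four_add_four]
  ring

lemma altTheta_half : altTheta (1 / 2) = (2 - √2) * realTheta 2 := by
  rw [altTheta, realTheta_half]
  norm_num
  ring

lemma altTheta_two_pow_pos (n : ℕ) : 0 < altTheta (2 ^ n * (1 / 2)) := by
  induction n with
  | zero =>
    rw [pow_zero, one_mul, altTheta_half]
    have h : √2 < 2 := by
      rw [Real.sqrt_lt' two_pos]
      norm_num
    exact mul_pos (by linarith) (realTheta_pos two_pos)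
  | succ n ih =>
    have hn : (0 : ℝ) < 2 ^ n * (1 / 2) := by positivity
    have hn' : (0 : ℝ) < 2 * (2 ^ n * (1 / 2)) := by positivity
    rw [show (2 : ℝ) ^ (n + 1) * (1 / 2) = 2 * (2 ^ n * (1 / 2)) by ring]
    have h := realTheta_mul_altTheta hn
    have h' := realTheta_mul_altTheta hn'
    have hF := mul_pos (realTheta_pos hn) ih
    have hne : altTheta (2 * (2 ^ n * (1 / 2))) ≠ 0 := fun h0 => by
      rw [h, h0] at hF
      norm_num at hF
    have hnn : 0 ≤ altTheta (2 * (2 ^ n * (1 / 2))) :=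
      nonneg_of_mul_nonneg_right (h' ▸ sq_nonneg _) (realTheta_pos hn')
    exact lt_of_le_of_ne hnn hne.symm

lemma ellipticIntegral_theta (n : ℕ) :
    ellipticIntegral (realTheta (2 ^ n * (1 / 2)) ^ 4) (altTheta (2 ^ n * (1 / 2)) ^ 4) =
      Real.pi := by
  have hstep : ∀ m : ℕ,
      ellipticIntegral (realTheta (2 ^ (m + 1) * (1 / 2)) ^ 4)
        (altTheta (2 ^ (m + 1) * (1 / 2)) ^ 4) =
      ellipticIntegral (realTheta (2 ^ m * (1 / 2)) ^ 4) (altTheta (2 ^ m * (1 / 2)) ^ 4) := by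
    intro m
    have hm : (0 : ℝ) < 2 ^ m * (1 / 2) := by positivity
    have h := ellipticIntegral_mean (pow_pos (realTheta_pos hm) 2)
      (pow_pos (altTheta_two_pow_pos m) 2)
    rw [realTheta_sq_add_altTheta_sq hm, ← mul_pow, realTheta_mul_altTheta hm] at h
    rw [show (2 : ℝ) ^ (m + 1) * (1 / 2) = 2 * (2 ^ m * (1 / 2)) by ring]
    convert h using 2 <;> ring
  have htop : Filter.Tendsto (fun m : ℕ => (2 : ℝ) ^ m * (1 / 2)) Filter.atTop Filter.atTop :=
    (tendsto_pow_atTop_atTop_of_one_lt one_lt_two).atTop_mul_const (by norm_num)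
  have hlim := tendsto_ellipticIntegral
    (by simpa [Function.comp_def] using (tendsto_realTheta.comp htop).pow 4)
    (by simpa [Function.comp_def] using (tendsto_altTheta.comp htop).pow 4)
  have hconst : ∀ k : ℕ,
      ellipticIntegral (realTheta (2 ^ (n + k) * (1 / 2)) ^ 4)
        (altTheta (2 ^ (n + k) * (1 / 2)) ^ 4) =
      ellipticIntegral (realTheta (2 ^ n * (1 / 2)) ^ 4) (altTheta (2 ^ n * (1 / 2)) ^ 4) := by
    intro k
    induction k with
    | zero => rfl
    | succ k ih => rw [← ih, ← hstep (n + k), add_assoc]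
  refine tendsto_nhds_unique ?_ hlim
  refine tendsto_const_nhds.congr' ?_
  filter_upwards [Filter.eventually_ge_atTop n] with m hm
  obtain ⟨k, rfl⟩ := Nat.exists_eq_add_of_le hm
  simpa using (hconst k).symm

lemma realTheta_one_sq : realTheta 1 ^ 2 = √2 * altTheta 1 ^ 2 := by
  have h1 := realTheta_sq_add_altTheta_sq (t := 1 / 2) (by norm_num)
  have h2 := realTheta_mul_altTheta (t := 1 / 2) (by norm_num)
  rw [altTheta_half, realTheta_half] at h1 h2
  norm_num at h1 h2
  have hs : √2 ^ 2 = 2 := Real.sq_sqrt (by norm_num)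
  rw [← h2]
  linear_combination (-1 / 2) * h1 + realTheta 2 ^ 2 * (√2 - 1) * hs

lemma realTheta_one_pow_four : realTheta 1 ^ 4 = Real.Gamma (1 / 4) ^ 4 / (4 * Real.pi ^ 3) := by
  have h1 := ellipticIntegral_theta 1
  norm_num at h1
  have hg : 0 < altTheta 1 := by simpa using altTheta_two_pow_pos 1
  have hs : √2 ^ 2 = 2 := Real.sq_sqrt (by norm_num)
  have hF4 : realTheta 1 ^ 4 = 2 * altTheta 1 ^ 4 := by
    linear_combination (realTheta 1 ^ 2 + √2 * altTheta 1 ^ 2) * realTheta_one_sq +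
      altTheta 1 ^ 4 * hs
  have h2 := ellipticIntegral_smul (pow_pos hg 2) 1 2
  have hcomm : ∀ c p : ℝ, ellipticIntegral c p = ellipticIntegral p c := fun c p => by
    simp only [ellipticIntegral, mul_comm]
  rw [hcomm, hF4, show altTheta 1 ^ 4 = (altTheta 1 ^ 2) ^ 2 * 1 by ring,
    show 2 * ((altTheta 1 ^ 2) ^ 2 * 1) = (altTheta 1 ^ 2) ^ 2 * 2 by ring, h2,
    ellipticIntegral_one_two] at h1
  have hpi := Real.pi_pos
  have hsp : √Real.pi ^ 2 = Real.pi := Real.sq_sqrt hpi.le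
  have h3 : altTheta 1 ^ 2 = Real.Gamma (1 / 4) ^ 2 / (2 * √2 * √Real.pi * Real.pi) := by
    field_simp at h1 ⊢
    linarith
  have h4 : realTheta 1 ^ 2 = Real.Gamma (1 / 4) ^ 2 / (2 * √Real.pi * Real.pi) := by
    rw [realTheta_one_sq, h3]
    field_simp
  rw [show realTheta 1 ^ 4 = (realTheta 1 ^ 2) ^ 2 by ring, h4, div_pow, mul_pow, mul_pow, hsp]
  ring

/-- θ_{0,0}(0,i) = Γ(1/4)/(4π³)^{1/4}. -/
theorem theta_const_gamma :
    theta 0 0 0 Complex.I =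
      ((Real.Gamma (1/4) / (4 * Real.pi ^ 3) ^ ((1 : ℝ)/4) : ℝ) : ℂ) := by
  have h : theta 0 0 0 Complex.I = (realTheta 1 : ℂ) := by
    rw [theta_zero_eq_jacobiTheta, ofReal_realTheta, Complex.ofReal_one, one_mul]
  have hG : 0 < Real.Gamma (1 / 4) := Real.Gamma_pos_of_pos (by norm_num)
  have hpi := Real.pi_pos
  rw [h, Complex.ofReal_inj]
  refine (pow_left_inj₀ (realTheta_pos one_pos).le (by positivity) four_ne_zero).1 ?_
  rw [realTheta_one_pow_four, div_pow, ← Real.rpow_natCast (_ ^ ((1 : ℝ) / 4)),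
    ← Real.rpow_mul (by positivity)]
  norm_num
end

section
/- θ_{0,0}(0,i) = π^{1/4} / Γ(3/4). -/
open Complex Real

open MeasureTheory Set Filter Topology

section ThetaConstants

/-- The theta constant `θ₃(it)` for real `t`. -/
noncomputable def thetaThree (t : ℝ) : ℝ := ∑' n : ℤ, Real.exp (-π * t * n ^ 2)

/-- The theta constant `θ₄(it)` for real `t`. -/
noncomputable def thetaFour (t : ℝ) : ℝ := ∑' n : ℤ, (-1 : ℝ) ^ n * Real.exp (-π * t * n ^ 2)

variable {t : ℝ}

lemma summable_exp_neg_pi_mul_int_sq (ht : 0 < t) :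
    Summable fun n : ℤ ↦ Real.exp (-π * t * n ^ 2) := by
  refine (HurwitzZeta.hasSum_int_evenKernel 0 ht).summable.congr fun n ↦ ?_
  congr 1
  ring

lemma norm_neg_one_zpow_mul (n : ℤ) (x : ℝ) : ‖(-1 : ℝ) ^ n * x‖ = ‖x‖ := by
  simp

lemma thetaThree_pos (ht : 0 < t) : 0 < thetaThree t :=
  (summable_exp_neg_pi_mul_int_sq ht).tsum_pos (fun _ ↦ (Real.exp_pos _).le) 0 (Real.exp_pos _)

lemma thetaThree_eq_inv_sqrt_mul (ht : 0 < t) :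
    thetaThree t = 1 / √t * thetaThree (1 / t) := by
  unfold thetaThree
  rw [Real.tsum_exp_neg_mul_int_sq ht, Real.sqrt_eq_rpow]
  simp only [mul_one_div]

/-- Change of variables `(a, b) ↦ (a + b, a - b)` in a sum over pairs of the same parity. -/
lemma tsum_comp_add_sub {h : ℤ × ℤ → ℝ} (hh : ∀ z : ℤ × ℤ, Odd (z.1 + z.2) → h z = 0) :
    ∑' z : ℤ × ℤ, h (z.1 + z.2, z.1 - z.2) = ∑' z, h z := by
  have hinj : Function.Injective fun z : ℤ × ℤ ↦ (z.1 + z.2, z.1 - z.2) := by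
    rintro ⟨a, b⟩ ⟨c, d⟩ h
    simp only [Prod.mk.injEq] at h ⊢
    omega
  refine hinj.tsum_eq fun z hz ↦ ?_
  obtain ⟨k, hk⟩ := Int.not_odd_iff_even.1 (mt (hh z) hz)
  exact ⟨(k, z.1 - k), Prod.ext (by simp) (by simp only; omega)⟩

lemma exp_mul_exp_comp_add_sub (t : ℝ) (a b : ℤ) :
    Real.exp (-π * t * ((a + b : ℤ) : ℝ) ^ 2) * Real.exp (-π * t * ((a - b : ℤ) : ℝ) ^ 2) =
      Real.exp (-π * (2 * t) * a ^ 2) * Real.exp (-π * (2 * t) * b ^ 2) := by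
  rw [← Real.exp_add, ← Real.exp_add]
  congr 1
  push_cast
  ring

lemma thetaThree_sq_add_thetaFour_sq (ht : 0 < t) :
    thetaThree t ^ 2 + thetaFour t ^ 2 = 2 * thetaThree (2 * t) ^ 2 := by
  have s := (summable_exp_neg_pi_mul_int_sq ht).norm
  have s' : Summable fun n : ℤ ↦ ‖(-1 : ℝ) ^ n * Real.exp (-π * t * n ^ 2)‖ := by
    simpa only [norm_neg_one_zpow_mul] using s
  have s2 := (summable_exp_neg_pi_mul_int_sq (mul_pos two_pos ht)).norm
  simp only [sq (thetaThree _), sq (thetaFour _)]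
  unfold thetaThree thetaFour
  rw [tsum_mul_tsum_of_summable_norm s s, tsum_mul_tsum_of_summable_norm s' s',
    tsum_mul_tsum_of_summable_norm s2 s2, ← (summable_mul_of_summable_norm s s).tsum_add
      (summable_mul_of_summable_norm s' s'), ← tsum_mul_left, ← tsum_comp_add_sub]
  · refine tsum_congr fun z ↦ ?_
    rw [← exp_mul_exp_comp_add_sub t z.1 z.2, mul_mul_mul_comm, ← zpow_add₀ (by norm_num),
      Even.neg_one_zpow ⟨z.1, by ring⟩]
    ring
  · intro z hz
    rw [mul_mul_mul_comm, ← zpow_add₀ (by norm_num), hz.neg_one_zpow]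
    ring

lemma thetaThree_mul_thetaFour (ht : 0 < t) :
    thetaThree t * thetaFour t = thetaFour (2 * t) ^ 2 := by
  have s := (summable_exp_neg_pi_mul_int_sq ht).norm
  have s' : Summable fun n : ℤ ↦ ‖(-1 : ℝ) ^ n * Real.exp (-π * t * n ^ 2)‖ := by
    simpa only [norm_neg_one_zpow_mul] using s
  have s2 : Summable fun n : ℤ ↦ ‖(-1 : ℝ) ^ n * Real.exp (-π * (2 * t) * n ^ 2)‖ := by
    simpa only [norm_neg_one_zpow_mul] using
      (summable_exp_neg_pi_mul_int_sq (mul_pos two_pos ht)).norm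
  suffices thetaThree t * thetaFour t + thetaFour t * thetaThree t = 2 * thetaFour (2 * t) ^ 2 by
    linarith
  rw [sq]
  unfold thetaThree thetaFour
  rw [tsum_mul_tsum_of_summable_norm s s', tsum_mul_tsum_of_summable_norm s' s,
    tsum_mul_tsum_of_summable_norm s2 s2, ← (summable_mul_of_summable_norm s s').tsum_add
      (summable_mul_of_summable_norm s' s), ← tsum_mul_left, ← tsum_comp_add_sub]
  · refine tsum_congr fun z ↦ ?_
    have h : (-1 : ℝ) ^ (z.1 - z.2) = (-1) ^ (z.1 + z.2) := by
      rw [show z.1 + z.2 = z.1 - z.2 + (z.2 + z.2) by ring, zpow_add₀ (by norm_num) (z.1 - z.2),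
        Even.neg_one_zpow ⟨z.2, rfl⟩, mul_one]
    rw [mul_mul_mul_comm ((-1 : ℝ) ^ z.1), ← exp_mul_exp_comp_add_sub t z.1 z.2,
      ← zpow_add₀ (by norm_num)]
    simp only [h]
    ring
  · intro z hz
    have h : (-1 : ℝ) ^ z.1 = -(-1) ^ z.2 := by
      rw [show z.1 = z.1 + z.2 + -z.2 by ring, zpow_add₀ (by norm_num), hz.neg_one_zpow,
        zpow_neg, ← inv_zpow]
      norm_num
    rw [h]
    ring

lemma tendsto_thetaThree_thetaFour_atTop :
    Tendsto thetaThree atTop (𝓝 1) ∧ Tendsto thetaFour atTop (𝓝 1) := by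
  have key (n : ℤ) : Tendsto (fun t : ℝ ↦ Real.exp (-π * t * n ^ 2)) atTop
      (𝓝 (if n = 0 then 1 else 0)) := by
    split_ifs with hn
    · simp [hn]
    · have hn' : 0 < π * (n : ℝ) ^ 2 := by positivity
      refine (Real.tendsto_exp_neg_atTop_nhds_zero.comp
        (tendsto_id.const_mul_atTop hn')).congr fun t ↦ ?_
      simp only [Function.comp, id]
      congr 1
      ring
  have bound : ∀ᶠ t : ℝ in atTop, ∀ n : ℤ,
      ‖Real.exp (-π * t * n ^ 2)‖ ≤ Real.exp (-π * 1 * n ^ 2) := by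
    filter_upwards [eventually_ge_atTop 1] with t ht n
    rw [Real.norm_of_nonneg (Real.exp_pos _).le, Real.exp_le_exp]
    have : 0 ≤ π * (n : ℝ) ^ 2 := by positivity
    nlinarith
  have s := summable_exp_neg_pi_mul_int_sq one_pos
  constructor
  · have h := tendsto_tsum_of_dominated_convergence s key bound
    rwa [tsum_eq_single 0 fun n hn ↦ if_neg hn, if_pos rfl] at h
  · have h := tendsto_tsum_of_dominated_convergence s
      (fun n : ℤ ↦ (key n).const_mul ((-1 : ℝ) ^ n)) (by simpa using bound)
    rwa [tsum_eq_single 0 fun n hn ↦ by rw [if_neg hn, mul_zero], if_pos rfl, zpow_zero,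
      mul_one] at h

/-- The value at `t = 1` of the ratio `θ₃² / θ₄²`. -/
lemma thetaThree_one_sq : thetaThree 1 ^ 2 = √2 * thetaFour 1 ^ 2 := by
  have h1 := thetaThree_sq_add_thetaFour_sq one_pos
  have h2 := thetaThree_sq_add_thetaFour_sq (t := 1 / 2) (by norm_num)
  have h3 := thetaThree_mul_thetaFour (t := 1 / 2) (by norm_num)
  have h4 := thetaThree_eq_inv_sqrt_mul (t := 2) two_pos
  rw [one_div, inv_mul_eq_div, eq_div_iff (by positivity)] at h4
  have h5 : thetaThree (1 / 2) ^ 2 = 2 * thetaThree 2 ^ 2 := by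
    rw [← h4, mul_pow, Real.sq_sqrt two_pos.le, mul_comm]
  norm_num at h1 h2 h3 h5
  have h6 : (thetaThree 1 ^ 2) ^ 2 = (√2 * thetaFour 1 ^ 2) ^ 2 := by
    rw [mul_pow, Real.sq_sqrt two_pos.le]
    have h7 : (thetaThree (1 / 2) * thetaFour (1 / 2)) ^ 2 = (thetaFour 1 ^ 2) ^ 2 := by rw [h3]
    rw [mul_pow, show thetaFour (1 / 2) ^ 2 = thetaThree 1 ^ 2 - thetaFour 1 ^ 2 by linarith,
      show thetaThree (1 / 2) ^ 2 = thetaThree 1 ^ 2 + thetaFour 1 ^ 2 by linarith] at h7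
    linarith
  exact (pow_left_inj₀ (by positivity) (by positivity) two_ne_zero).1 h6

lemma thetaFour_two_pow_ne_zero (k : ℕ) : thetaFour (2 ^ k) ≠ 0 := by
  induction k with
  | zero =>
    intro h
    have h1 := thetaThree_one_sq
    rw [pow_zero] at h
    rw [h] at h1
    simp [(thetaThree_pos one_pos).ne'] at h1
  | succ k ih =>
    have h := thetaThree_mul_thetaFour (t := 2 ^ k) (by positivity)
    rw [pow_succ']
    intro h0
    rw [h0] at h
    simp [ih, (thetaThree_pos (t := 2 ^ k) (by positivity)).ne'] at h

end ThetaConstants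

section EllipticIntegral

/-- The complete elliptic integral attached to the arithmetic-geometric mean of `a` and `b`. -/
noncomputable def agmIntegral (a b : ℝ) : ℝ :=
  ∫ x in Ioi 0, (√((x ^ 2 + a ^ 2) * (x ^ 2 + b ^ 2)))⁻¹

lemma two_mul_agmIntegral (a b : ℝ) :
    2 * agmIntegral a b = ∫ x, (√((x ^ 2 + a ^ 2) * (x ^ 2 + b ^ 2)))⁻¹ := by
  rw [agmIntegral, ← integral_comp_abs]
  simp

/-- Gauss's transformation: the substitution `u = (x - ab / x) / 2` replaces `a` and `b` by their
arithmetic and geometric means. -/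
lemma agmIntegral_mean {a b c : ℝ} (hc : 0 < c) (h : a * b = c ^ 2) :
    agmIntegral ((a + b) / 2) c = agmIntegral a b := by
  have hd : ∀ x ∈ Ioi (0 : ℝ), HasDerivWithinAt (fun x ↦ (x - c ^ 2 / x) / 2)
      ((1 + c ^ 2 / x ^ 2) / 2) (Ioi 0) x := by
    intro x hx
    have hx' : x ≠ 0 := (mem_Ioi.1 hx).ne'
    have := (((hasDerivAt_id x).sub ((hasDerivAt_inv hx').const_mul (c ^ 2))).div_const 2)
    refine (this.congr_deriv ?_).hasDerivWithinAt
    field_simp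
    ring
  have hinj : InjOn (fun x : ℝ ↦ (x - c ^ 2 / x) / 2) (Ioi 0) := by
    intro x hx y hy hxy
    have hx : 0 < x := hx
    have hy : 0 < y := hy
    simp only at hxy
    field_simp at hxy
    have : (x - y) * (x * y + c ^ 2) = 0 := by linear_combination hxy
    rcases mul_eq_zero.1 this with h | h
    · linarith
    · nlinarith [mul_pos hx hy, sq_nonneg c]
  have himg : (fun x : ℝ ↦ (x - c ^ 2 / x) / 2) '' Ioi 0 = univ := by
    refine eq_univ_of_forall fun u ↦ ?_
    have hs : √(u ^ 2 + c ^ 2) ^ 2 = u ^ 2 + c ^ 2 := Real.sq_sqrt (by positivity)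
    have hlt : |u| < √(u ^ 2 + c ^ 2) := by
      rw [← Real.sqrt_sq_eq_abs]
      exact Real.sqrt_lt_sqrt (sq_nonneg u) (by nlinarith)
    have hpos : 0 < u + √(u ^ 2 + c ^ 2) := by linarith [neg_abs_le u]
    refine ⟨u + √(u ^ 2 + c ^ 2), hpos, ?_⟩
    field_simp
    linear_combination hs
  have key := integral_image_eq_integral_abs_deriv_smul measurableSet_Ioi hd hinj
    (fun u ↦ (√((u ^ 2 + ((a + b) / 2) ^ 2) * (u ^ 2 + c ^ 2)))⁻¹)
  rw [himg, setIntegral_univ, ← two_mul_agmIntegral] at key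
  suffices 2 * agmIntegral ((a + b) / 2) c = 2 * agmIntegral a b by linarith
  rw [key, agmIntegral, ← integral_const_mul]
  refine setIntegral_congr_fun measurableSet_Ioi fun x hx ↦ ?_
  have hx : 0 < x := hx
  have hfac : (((x - c ^ 2 / x) / 2) ^ 2 + ((a + b) / 2) ^ 2) * (((x - c ^ 2 / x) / 2) ^ 2 + c ^ 2) =
      ((x ^ 2 + a ^ 2) * (x ^ 2 + b ^ 2)) * ((x ^ 2 + c ^ 2) / (4 * x ^ 2)) ^ 2 := by
    rw [← h]
    field_simp
    ring
  have hq : 0 < (x ^ 2 + c ^ 2) / (4 * x ^ 2) := by positivity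
  simp only [smul_eq_mul]
  rw [hfac, Real.sqrt_mul (by positivity), Real.sqrt_sq hq.le, abs_of_pos (by positivity), mul_inv]
  field_simp
  ring

lemma agmIntegral_one_one : agmIntegral 1 1 = π / 2 := by
  have := integral_Ioi_inv_one_add_sq (i := 0)
  rw [Real.arctan_zero, sub_zero] at this
  rw [← this, agmIntegral]
  congr 1 with x
  rw [Real.sqrt_mul_self (by positivity), one_pow, add_comm]

lemma tendsto_agmIntegral_of_tendsto_one {a b : ℕ → ℝ} (ha : Tendsto a atTop (𝓝 1))
    (hb : Tendsto b atTop (𝓝 1)) :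
    Tendsto (fun k ↦ agmIntegral (a k) (b k)) atTop (𝓝 (π / 2)) := by
  rw [← agmIntegral_one_one]
  refine tendsto_integral_filter_of_dominated_convergence (fun x ↦ 4 * (1 + x ^ 2)⁻¹) ?_ ?_
    (integrable_inv_one_add_sq.const_mul 4).integrableOn ?_
  · exact .of_forall fun k ↦ by
      refine Measurable.aestronglyMeasurable ?_
      fun_prop
  · filter_upwards [ha.eventually (lt_mem_nhds (show (1 / 2 : ℝ) < 1 by norm_num)),
      hb.eventually (lt_mem_nhds (show (1 / 2 : ℝ) < 1 by norm_num))] with k hak hbk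
    refine .of_forall fun x ↦ ?_
    rw [Real.norm_of_nonneg (by positivity),
      show 4 * (1 + x ^ 2)⁻¹ = ((1 + x ^ 2) / 4)⁻¹ by field_simp]
    refine inv_anti₀ (by positivity) (Real.le_sqrt_of_sq_le ?_)
    rw [sq]
    gcongr <;> nlinarith [sq_nonneg x]
  · refine .of_forall fun x ↦ ?_
    have hne : √((x ^ 2 + 1 ^ 2) * (x ^ 2 + 1 ^ 2)) ≠ 0 := by positivity
    exact (((ha.pow 2).const_add (x ^ 2)).mul ((hb.pow 2).const_add (x ^ 2))).sqrt.inv₀ hne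

lemma agmIntegral_mul {c : ℝ} (hc : 0 < c) (a b : ℝ) :
    agmIntegral (c * a) (c * b) = c⁻¹ * agmIntegral a b := by
  have h := integral_comp_mul_left_Ioi
    (fun x ↦ (√((x ^ 2 + (c * a) ^ 2) * (x ^ 2 + (c * b) ^ 2)))⁻¹) 0 hc
  rw [mul_zero, smul_eq_mul, eq_inv_mul_iff_mul_eq₀ hc.ne'] at h
  rw [agmIntegral, ← h, agmIntegral, ← integral_const_mul, ← integral_const_mul]
  congr 1 with x
  rw [show ((c * x) ^ 2 + (c * a) ^ 2) * ((c * x) ^ 2 + (c * b) ^ 2) =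
    (c ^ 2) ^ 2 * ((x ^ 2 + a ^ 2) * (x ^ 2 + b ^ 2)) by ring, Real.sqrt_mul (by positivity),
    Real.sqrt_sq (by positivity), mul_inv]
  field_simp

/-- Euler's beta integral over the reals. -/
lemma setIntegral_Ioo_rpow_mul_one_sub_rpow {u v : ℝ} (hu : 0 < u) (hv : 0 < v) :
    ∫ x in Ioo (0 : ℝ) 1, x ^ (u - 1) * (1 - x) ^ (v - 1) =
      Real.Gamma u * Real.Gamma v / Real.Gamma (u + v) := by
  have h := Complex.betaIntegral_eq_Gamma_mul_div u v (by simpa) (by simpa)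
  rw [Complex.betaIntegral, intervalIntegral.integral_of_le zero_le_one,
    integral_Ioc_eq_integral_Ioo, ← Complex.ofReal_add] at h
  simp only [Complex.Gamma_ofReal] at h
  rw [← Complex.ofReal_inj, ← integral_complex_ofReal]
  push_cast
  rw [← h]
  refine setIntegral_congr_fun measurableSet_Ioo fun x hx ↦ ?_
  rw [Complex.ofReal_cpow hx.1.le, Complex.ofReal_cpow (sub_nonneg.2 hx.2.le)]
  push_cast
  rfl

/-- The lemniscatic case of the complete elliptic integral. -/
lemma agmIntegral_sqrt_two_one :
    agmIntegral √2 1 = Real.Gamma (1 / 4) * √π / (4 * Real.Gamma (3 / 4)) := by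
  have hd : ∀ x ∈ Ioi (0 : ℝ), HasDerivWithinAt (fun x : ℝ ↦ ((1 + x ^ 2) ^ 2)⁻¹)
      (-(4 * x / (1 + x ^ 2) ^ 3)) (Ioi 0) x := by
    intro x hx
    have h1 : (1 + x ^ 2) ^ 2 ≠ 0 := by positivity
    have := ((((hasDerivAt_id x).pow 2).const_add 1).pow 2).inv h1
    refine (this.congr_deriv ?_).hasDerivWithinAt
    simp only [id]
    field_simp
    simp
    ring
  have hinj : InjOn (fun x : ℝ ↦ ((1 + x ^ 2) ^ 2)⁻¹) (Ioi 0) := by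
    intro x hx y hy hxy
    have h1 := inv_injective hxy
    rw [pow_left_inj₀ (by positivity) (by positivity) two_ne_zero, add_right_inj,
      pow_left_inj₀ (le_of_lt hx) (le_of_lt hy) two_ne_zero] at h1
    exact h1
  have himg : (fun x : ℝ ↦ ((1 + x ^ 2) ^ 2)⁻¹) '' Ioi 0 = Ioo 0 1 := by
    ext w
    constructor
    · rintro ⟨x, hx, rfl⟩
      have hx : 0 < x := hx
      exact ⟨by positivity, inv_lt_one_of_one_lt₀ (one_lt_pow₀ (by nlinarith) two_ne_zero)⟩
    · rintro ⟨h0, h1⟩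
      have h2 : 1 < √w⁻¹ := by
        rw [Real.lt_sqrt zero_le_one, one_pow]
        exact (one_lt_inv₀ h0).2 h1
      refine ⟨√(√w⁻¹ - 1), Real.sqrt_pos.2 (by linarith), ?_⟩
      simp only
      rw [Real.sq_sqrt (by linarith), add_sub_cancel, Real.sq_sqrt (by positivity), inv_inv]
  have key := integral_image_eq_integral_abs_deriv_smul measurableSet_Ioi hd hinj
    (fun w ↦ w ^ ((1 / 4 : ℝ) - 1) * (1 - w) ^ ((1 / 2 : ℝ) - 1))
  rw [himg, setIntegral_Ioo_rpow_mul_one_sub_rpow (by norm_num) (by norm_num),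
    Real.Gamma_one_half_eq, show (1 / 4 + 1 / 2 : ℝ) = 3 / 4 by norm_num] at key
  suffices Real.Gamma (1 / 4) * √π / Real.Gamma (3 / 4) = 4 * agmIntegral √2 1 by
    rw [mul_comm (4 : ℝ), ← div_div, this]
    ring
  rw [key, agmIntegral, ← integral_const_mul]
  refine setIntegral_congr_fun measurableSet_Ioi fun x hx ↦ ?_
  have hx : 0 < x := hx
  have hp : 0 < 1 + x ^ 2 := by positivity
  have e1 : (((1 + x ^ 2) ^ 2)⁻¹) ^ ((1 / 4 : ℝ) - 1) = (1 + x ^ 2) * √(1 + x ^ 2) := by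
    rw [Real.inv_rpow (by positivity), ← Real.rpow_neg (by positivity), ← Real.rpow_natCast,
      ← Real.rpow_mul hp.le, Real.sqrt_eq_rpow, ← Real.rpow_one_add' hp.le (by norm_num)]
    norm_num
  have e2 : (1 - ((1 + x ^ 2) ^ 2)⁻¹) ^ ((1 / 2 : ℝ) - 1) =
      (1 + x ^ 2) / (x * √(x ^ 2 + 2)) := by
    have : 1 - ((1 + x ^ 2) ^ 2)⁻¹ = (x / (1 + x ^ 2)) ^ 2 * (x ^ 2 + 2) := by
      field_simp
      ring
    rw [this, show (1 / 2 : ℝ) - 1 = -(1 / 2) by norm_num, Real.rpow_neg (by positivity),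
      ← Real.sqrt_eq_rpow, Real.sqrt_mul (by positivity), Real.sqrt_sq (by positivity)]
    field_simp
  simp only [smul_eq_mul]
  rw [e1, e2, abs_neg, abs_of_pos (by positivity), Real.sq_sqrt two_pos.le, one_pow,
    Real.sqrt_mul (by positivity), add_comm (x ^ 2) 1]
  have hs : √(1 + x ^ 2) ^ 2 = 1 + x ^ 2 := Real.sq_sqrt hp.le
  field_simp
  rw [hs]

end EllipticIntegral

lemma agmIntegral_thetaThree_sq_thetaFour_sq :
    agmIntegral (thetaThree 1 ^ 2) (thetaFour 1 ^ 2) = π / 2 := by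
  have hconst (k : ℕ) : agmIntegral (thetaThree (2 ^ k) ^ 2) (thetaFour (2 ^ k) ^ 2) =
      agmIntegral (thetaThree 1 ^ 2) (thetaFour 1 ^ 2) := by
    induction k with
    | zero => simp
    | succ k ih =>
      have ht : (0 : ℝ) < 2 ^ k := by positivity
      have h4 := thetaFour_two_pow_ne_zero (k + 1)
      have hmul : thetaThree (2 ^ k) ^ 2 * thetaFour (2 ^ k) ^ 2 =
          (thetaFour (2 ^ (k + 1)) ^ 2) ^ 2 := by
        rw [← mul_pow, thetaThree_mul_thetaFour ht, ← pow_succ']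
      rw [← ih, ← agmIntegral_mean (by positivity) hmul, thetaThree_sq_add_thetaFour_sq ht,
        mul_div_cancel_left₀ _ two_ne_zero, ← pow_succ']
  have hpow : Tendsto (fun k : ℕ ↦ (2 : ℝ) ^ k) atTop atTop :=
    tendsto_pow_atTop_atTop_of_one_lt one_lt_two
  obtain ⟨h3, h4⟩ := tendsto_thetaThree_thetaFour_atTop
  have hlim := tendsto_agmIntegral_of_tendsto_one
    (by simpa using (h3.comp hpow).pow 2) (by simpa using (h4.comp hpow).pow 2)
  exact tendsto_nhds_unique (tendsto_const_nhds.congr fun k ↦ (hconst k).symm) hlim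

/-- The lemniscatic value of `θ₃`. -/
lemma thetaThree_one : thetaThree 1 = π ^ ((1 : ℝ) / 4) / Real.Gamma (3 / 4) := by
  have hG : 0 < Real.Gamma (3 / 4) := Real.Gamma_pos_of_pos (by norm_num)
  have h4 : thetaFour 1 ≠ 0 := by simpa using thetaFour_two_pow_ne_zero 0
  have h := agmIntegral_thetaThree_sq_thetaFour_sq
  have hrefl := Real.Gamma_mul_Gamma_one_sub (1 / 4)
  rw [show (1 : ℝ) - 1 / 4 = 3 / 4 by norm_num, mul_one_div, Real.sin_pi_div_four] at hrefl
  rw [thetaThree_one_sq, mul_comm, ← mul_one (thetaFour 1 ^ 2), mul_assoc, one_mul,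
    agmIntegral_mul (by positivity), agmIntegral_sqrt_two_one] at h
  have hsq : thetaThree 1 ^ 2 = √π / Real.Gamma (3 / 4) ^ 2 := by
    rw [thetaThree_one_sq]
    have hpi : 0 < π := Real.pi_pos
    field_simp at h hrefl ⊢
    refine mul_left_cancel₀ (mul_ne_zero four_ne_zero hpi.ne') ?_
    linear_combination -(Real.Gamma (3 / 4) * √2) * h + 2 * √π * hrefl
  rw [← pow_left_inj₀ (thetaThree_pos one_pos).le (by positivity) two_ne_zero, hsq, div_pow,
    ← Real.rpow_mul_natCast Real.pi_pos.le, Real.sqrt_eq_rpow]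
  norm_num

/-- θ_{0,0}(0,i) = π^{1/4}/Γ(3/4). -/
theorem theta_const_gamma' :
    theta 0 0 0 Complex.I =
      ((Real.pi ^ ((1 : ℝ)/4) / Real.Gamma (3/4) : ℝ) : ℂ) := by
  rw [← thetaThree_one, thetaThree, theta, Complex.ofReal_tsum]
  refine tsum_congr fun n ↦ ?_
  rw [Complex.ofReal_exp]
  congr 1
  push_cast
  linear_combination (π * n ^ 2 : ℂ) * Complex.I_sq
end

section
/- Jacobi's derivative formula: ∂θ_{1/2,1/2}/∂z (0,τ) = −π · θ_{0,0}(0,τ) · θ_{0,1/2}(0,τ) · θ_{1/2,0}(0,τ) for every τ in the upper half-plane. -/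
open Complex Real

open Filter Topology

/-- The general term of the series defining `theta`. -/
noncomputable def thetaTerm (a b : ℝ) (z τ : ℂ) (n : ℤ) : ℂ :=
  cexp (π * I * ((n : ℂ) + (a : ℂ)) ^ 2 * τ + 2 * π * I * ((n : ℂ) + (a : ℂ)) * (z + (b : ℂ)))

/-- The exponential factor relating `theta` to `jacobiTheta₂`. -/
noncomputable def thetaFactor (a b : ℝ) (z τ : ℂ) : ℂ :=
  cexp (π * I * (a : ℂ) ^ 2 * τ + 2 * π * I * (a : ℂ) * (z + (b : ℂ)))

lemma thetaTerm_eq (a b : ℝ) (z τ : ℂ) (n : ℤ) :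
    thetaTerm a b z τ n = thetaFactor a b z τ * jacobiTheta₂_term n (z + b + a * τ) τ := by
  rw [thetaTerm, thetaFactor, jacobiTheta₂_term, ← Complex.exp_add]
  ring_nf

lemma summable_thetaTerm (a b : ℝ) (z : ℂ) {τ : ℂ} (hτ : 0 < τ.im) :
    Summable (thetaTerm a b z τ) := by
  simp_rw [funext (thetaTerm_eq a b z τ)]
  exact ((summable_jacobiTheta₂_term_iff _ τ).mpr hτ).mul_left _

lemma hasSum_thetaTerm (a b : ℝ) (z : ℂ) {τ : ℂ} (hτ : 0 < τ.im) :
    HasSum (thetaTerm a b z τ) (theta a b z τ) :=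
  (summable_thetaTerm a b z hτ).hasSum

lemma theta_eq_jacobiTheta₂ (a b : ℝ) (z τ : ℂ) :
    theta a b z τ = thetaFactor a b z τ * jacobiTheta₂ (z + b + a * τ) τ := by
  rw [jacobiTheta₂, ← tsum_mul_left]
  exact tsum_congr (thetaTerm_eq a b z τ)

lemma hasDerivAt_theta (a b : ℝ) (z : ℂ) {τ : ℂ} (hτ : 0 < τ.im) :
    HasDerivAt (fun w => theta a b w τ)
      (thetaFactor a b z τ * (2 * π * I * a * jacobiTheta₂ (z + b + a * τ) τ +
        jacobiTheta₂' (z + b + a * τ) τ)) z := by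
  simp_rw [theta_eq_jacobiTheta₂]
  have hl : HasDerivAt (fun w : ℂ => w + b + a * τ) 1 z :=
    ((hasDerivAt_id z).add_const _).add_const _
  have h1 : HasDerivAt (fun w => jacobiTheta₂ (w + b + a * τ) τ)
      (jacobiTheta₂' (z + b + a * τ) τ) z := by
    have := (hasDerivAt_jacobiTheta₂_fst (z + b + a * τ) hτ).comp z hl
    rwa [mul_one] at this
  have h2 : HasDerivAt (fun w => thetaFactor a b w τ)
      (thetaFactor a b z τ * (2 * π * I * a)) z := by
    have := ((((hasDerivAt_id z).add_const (b : ℂ)).const_mul (2 * π * I * (a : ℂ))).const_add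
      (π * I * (a : ℂ) ^ 2 * τ)).cexp
    simpa [thetaFactor] using this
  exact (h2.mul h1).congr_deriv (by ring)

lemma hasSum_deriv_theta (a b : ℝ) (z : ℂ) {τ : ℂ} (hτ : 0 < τ.im) :
    HasSum (fun n : ℤ => 2 * π * I * (n + a) * thetaTerm a b z τ n)
      (deriv (fun w => theta a b w τ) z) := by
  rw [(hasDerivAt_theta a b z hτ).deriv]
  have h : (fun n : ℤ => 2 * π * I * (n + a) * thetaTerm a b z τ n) = fun n : ℤ =>
      thetaFactor a b z τ * (2 * π * I * a * jacobiTheta₂_term n (z + b + a * τ) τ +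
        jacobiTheta₂'_term n (z + b + a * τ) τ) := by
    funext n
    rw [thetaTerm_eq, jacobiTheta₂'_term]
    ring
  rw [h]
  exact (((hasSum_jacobiTheta₂_term _ hτ).mul_left _).add
    (hasSum_jacobiTheta₂'_term _ hτ)).mul_left _

/-- Pairs of integers, split by the parity of their sum, in coordinates
`(m, n) = (j + k + s, j - k)` with `s ∈ {0, 1}`. -/
def intProdEquiv : (ℤ × ℤ) ⊕ (ℤ × ℤ) ≃ ℤ × ℤ where
  toFun := Sum.elim (fun p => (p.1 + p.2, p.1 - p.2)) (fun p => (p.1 + p.2 + 1, p.1 - p.2))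
  invFun p := if (p.1 + p.2) % 2 = 0 then Sum.inl ((p.1 + p.2) / 2, (p.1 - p.2) / 2)
    else Sum.inr ((p.1 + p.2) / 2, (p.1 - p.2) / 2)
  left_inv := by
    rintro (⟨j, k⟩ | ⟨j, k⟩)
    · have h : (j + k + (j - k)) % 2 = 0 := by omega
      simp only [Sum.elim_inl, h, if_true, Sum.inl.injEq, Prod.mk.injEq]
      omega
    · have h : ¬ (j + k + 1 + (j - k)) % 2 = 0 := by omega
      simp only [Sum.elim_inr, h, if_false, Sum.inr.injEq, Prod.mk.injEq]
      omega
  right_inv := by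
    rintro ⟨m, n⟩
    by_cases h : (m + n) % 2 = 0
    · simp only [h, if_true, Sum.elim_inl, Prod.mk.injEq]
      omega
    · simp only [h, if_false, Sum.elim_inr, Prod.mk.injEq]
      omega

lemma im_two_mul_pos {τ : ℂ} (hτ : 0 < τ.im) : 0 < (2 * τ).im := by
  simpa using hτ

lemma hasSum_thetaTerm_mul (a b c d : ℝ) (z w : ℂ) {τ : ℂ} (hτ : 0 < τ.im) :
    HasSum (fun p : ℤ × ℤ => thetaTerm a b z τ p.1 * thetaTerm c d w τ p.2)
      (theta a b z τ * theta c d w τ) :=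
  (hasSum_thetaTerm a b z hτ).mul (hasSum_thetaTerm c d w hτ)
    (summable_mul_of_summable_norm (summable_thetaTerm a b z hτ).norm
      (summable_thetaTerm c d w hτ).norm)

/-- The product of two theta functions of modulus `τ` in terms of those of modulus `2 * τ`. -/
theorem theta_mul_theta (a b c d : ℝ) (z w : ℂ) {τ : ℂ} (hτ : 0 < τ.im) :
    theta a b z τ * theta c d w τ =
      theta ((a + c) / 2) (b + d) (z + w) (2 * τ) *
          theta ((a - c) / 2) (b - d) (z - w) (2 * τ) +
        theta ((a + c + 1) / 2) (b + d) (z + w) (2 * τ) *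
          theta ((a - c + 1) / 2) (b - d) (z - w) (2 * τ) := by
  have h2 := im_two_mul_pos hτ
  have h := intProdEquiv.hasSum_iff.mpr (hasSum_thetaTerm_mul a b c d z w hτ)
  refine h.unique (HasSum.sum ?_ ?_)
  · convert hasSum_thetaTerm_mul ((a + c) / 2) (b + d) ((a - c) / 2) (b - d) (z + w) (z - w) h2
      using 2 with p
    simp only [Function.comp_apply, intProdEquiv, Equiv.coe_fn_mk, Sum.elim_inl, thetaTerm,
      ← Complex.exp_add]
    push_cast
    ring_nf
  · convert hasSum_thetaTerm_mul ((a + c + 1) / 2) (b + d) ((a - c + 1) / 2) (b - d)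
      (z + w) (z - w) h2 using 2 with p
    simp only [Function.comp_apply, intProdEquiv, Equiv.coe_fn_mk, Sum.elim_inr, thetaTerm,
      ← Complex.exp_add]
    push_cast
    ring_nf

lemma theta_add_one_left (a b : ℝ) (z τ : ℂ) : theta (a + 1) b z τ = theta a b z τ := by
  refine Eq.trans ?_ ((Equiv.addRight (1 : ℤ)).tsum_eq (thetaTerm a b z τ))
  refine tsum_congr fun n => ?_
  simp only [thetaTerm, Equiv.coe_addRight]
  push_cast
  ring_nf

lemma theta_zero_neg_half (z τ : ℂ) : theta 0 (-(1 / 2)) z τ = theta 0 (1 / 2) z τ := by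
  refine tsum_congr fun n => ?_
  refine Complex.exp_eq_exp_iff_exists_int.mpr ⟨-n, ?_⟩
  push_cast
  ring

lemma theta_half_half_zero (τ : ℂ) : theta (1 / 2) (1 / 2) 0 τ = 0 := by
  have h : theta (1 / 2) (1 / 2) 0 τ = -theta (1 / 2) (1 / 2) 0 τ := by
    refine ((Equiv.subLeft (-1 : ℤ)).tsum_eq (thetaTerm (1 / 2) (1 / 2) 0 τ)).symm.trans ?_
    rw [theta, ← tsum_neg]
    refine tsum_congr fun n => ?_
    simp only [thetaTerm, Equiv.subLeft_apply]
    rw [neg_eq_neg_one_mul (cexp _), ← Complex.exp_pi_mul_I, ← Complex.exp_add]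
    refine Complex.exp_eq_exp_iff_exists_int.mpr ⟨-n - 1, ?_⟩
    push_cast
    ring
  exact self_eq_neg.mp h

/-- The duplication formula for `θ_{0,0} * θ_{0,1/2}`. -/
lemma theta_zero_mul_theta_zero_half {τ : ℂ} (hτ : 0 < τ.im) :
    theta 0 0 0 τ * theta 0 (1 / 2) 0 τ = theta 0 (1 / 2) 0 (2 * τ) ^ 2 := by
  have h := theta_half_half_zero (2 * τ)
  have h' := theta_zero_neg_half 0 (2 * τ)
  rw [theta_mul_theta _ _ _ _ _ _ hτ]
  norm_num at h h' ⊢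
  rw [h, h']
  ring

/-- The duplication formula for `θ_{1/2,0} ^ 2`. -/
lemma theta_half_zero_sq {τ : ℂ} (hτ : 0 < τ.im) :
    theta (1 / 2) 0 0 τ ^ 2 = 2 * theta (1 / 2) 0 0 (2 * τ) * theta 0 0 0 (2 * τ) := by
  have h1 := theta_add_one_left 0 0 0 (2 * τ)
  rw [sq, theta_mul_theta _ _ _ _ _ _ hτ]
  norm_num at h1 ⊢
  rw [h1]
  ring

lemma theta_half_half_mul_theta_half_zero (z : ℂ) {τ : ℂ} (hτ : 0 < τ.im) :
    theta (1 / 2) (1 / 2) z τ * theta (1 / 2) 0 z τ =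
      theta (1 / 2) (1 / 2) (2 * z) (2 * τ) * theta 0 (1 / 2) 0 (2 * τ) := by
  have h := theta_half_half_zero (2 * τ)
  rw [theta_mul_theta _ _ _ _ _ _ hτ]
  norm_num at h ⊢
  rw [h, ← two_mul]
  ring

/-- The duplication formula for the derivative of `θ_{1/2,1/2}` at the origin. -/
lemma deriv_theta_mul_theta_half_zero {τ : ℂ} (hτ : 0 < τ.im) :
    deriv (fun z => theta (1 / 2) (1 / 2) z τ) 0 * theta (1 / 2) 0 0 τ =
      2 * deriv (fun z => theta (1 / 2) (1 / 2) z (2 * τ)) 0 * theta 0 (1 / 2) 0 (2 * τ) := by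
  have hA := (hasDerivAt_theta (1 / 2) (1 / 2) 0 hτ).differentiableAt.hasDerivAt
  have hB := (hasDerivAt_theta (1 / 2) 0 0 hτ).differentiableAt.hasDerivAt
  have hC := (hasDerivAt_theta (1 / 2) (1 / 2) (2 * 0)
    (im_two_mul_pos hτ)).differentiableAt.hasDerivAt
  have hD := (hC.comp 0 ((hasDerivAt_id (0 : ℂ)).const_mul 2)).mul_const
    (theta 0 (1 / 2) 0 (2 * τ))
  have hE := hA.mul hB
  have hfun : (fun z => theta (1 / 2) (1 / 2) z τ) * (fun z => theta (1 / 2) 0 z τ) =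
      fun z => theta (1 / 2) (1 / 2) (2 * z) (2 * τ) * theta 0 (1 / 2) 0 (2 * τ) :=
    funext fun z => theta_half_half_mul_theta_half_zero z hτ
  rw [hfun] at hE
  have h := hE.unique hD
  rw [theta_half_half_zero, zero_mul, add_zero] at h
  rw [h, mul_zero]
  ring

lemma im_two_pow_mul_pos {τ : ℂ} (hτ : 0 < τ.im) (k : ℕ) : 0 < (2 ^ k * τ).im := by
  have h : (2 ^ k * τ : ℂ) = ((2 ^ k : ℝ) : ℂ) * τ := by push_cast; rfl
  rw [h, Complex.im_ofReal_mul]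
  positivity

/-- Along `2 ^ k * τ`, a series of exponentials tends to the sum of its constant terms. -/
lemma tendsto_tsum_exp_two_pow_mul {τ : ℂ} (hτ : 0 < τ.im) (c : ℤ → ℂ) (e : ℤ → ℝ)
    (he : ∀ n, 0 ≤ e n) (hs : Summable fun n => c n * cexp (π * I * e n * τ)) :
    Tendsto (fun k : ℕ => ∑' n, c n * cexp (π * I * e n * (2 ^ k * τ))) atTop
      (𝓝 (∑' n, if e n = 0 then c n else 0)) := by
  have hnorm : ∀ (k : ℕ) (n : ℤ), ‖cexp (π * I * e n * (2 ^ k * τ))‖ =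
      rexp (-(π * e n * τ.im) * 2 ^ k) := by
    intro k n
    have h : (π * I * e n * (2 ^ k * τ) : ℂ) = ((π * e n * 2 ^ k : ℝ) : ℂ) * (I * τ) := by
      push_cast; ring
    rw [Complex.norm_exp, h, Complex.re_ofReal_mul, Complex.I_mul_re]
    ring_nf
  refine tendsto_tsum_of_dominated_convergence hs.norm (fun n => ?_) (.of_forall fun k n => ?_)
  · split_ifs with h
    · simp [h]
    · have hpos : 0 < π * e n * τ.im :=
        mul_pos (mul_pos pi_pos ((he n).lt_of_ne' h)) hτ
      rw [← mul_zero (c n)]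
      refine Tendsto.const_mul _ (tendsto_zero_iff_norm_tendsto_zero.mpr ?_)
      simp_rw [hnorm]
      exact Real.tendsto_exp_atBot.comp
        ((tendsto_pow_atTop_atTop_of_one_lt one_lt_two).const_mul_atTop_of_neg (neg_lt_zero.mpr hpos))
  · rw [norm_mul, norm_mul]
    refine mul_le_mul_of_nonneg_left ?_ (norm_nonneg _)
    have h0 := hnorm 0 n
    rw [pow_zero, one_mul, pow_zero, mul_one] at h0
    rw [hnorm, h0, Real.exp_le_exp, neg_mul, neg_le_neg_iff]
    exact le_mul_of_one_le_right (mul_nonneg (mul_nonneg pi_pos.le (he n)) hτ.le)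
      (one_le_pow₀ one_le_two)

lemma tendsto_theta_zero (b : ℝ) {τ : ℂ} (hτ : 0 < τ.im) :
    Tendsto (fun k : ℕ => theta 0 b 0 (2 ^ k * τ)) atTop (𝓝 1) := by
  have key : ∀ (σ : ℂ) (n : ℤ), thetaTerm 0 b 0 σ n =
      cexp (2 * π * I * n * b) * cexp (π * I * ((n ^ 2 : ℝ) : ℂ) * σ) := by
    intro σ n
    rw [thetaTerm, ← Complex.exp_add]
    push_cast
    ring_nf
  have h := tendsto_tsum_exp_two_pow_mul hτ (fun n => cexp (2 * π * I * n * b))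
    (fun n => (n : ℝ) ^ 2) (fun n => sq_nonneg _)
    (by simpa only [← key] using summable_thetaTerm 0 b 0 hτ)
  simp only [← key] at h
  have h1 : (∑' n : ℤ, if (n : ℝ) ^ 2 = 0 then cexp (2 * π * I * n * b) else 0) = 1 := by
    rw [tsum_eq_single 0]
    · simp
    · intro n hn
      simp [hn]
  rwa [h1] at h

lemma tsum_ite_mul_add_one (c : ℤ → ℂ) :
    (∑' n : ℤ, if (n : ℝ) * (n + 1) = 0 then c n else 0) = c 0 + c (-1) := by
  rw [tsum_eq_sum (s := {0, -1})]
  · simp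
  · intro n hn
    simp only [Finset.mem_insert, Finset.mem_singleton, not_or] at hn
    refine if_neg (mul_ne_zero (by exact_mod_cast hn.1) fun h => hn.2 ?_)
    have : n + 1 = 0 := by exact_mod_cast h
    omega

lemma intCast_mul_add_one_nonneg (n : ℤ) : (0 : ℝ) ≤ n * (n + 1) := by
  have h : (0 : ℤ) ≤ n * (n + 1) := by
    rcases le_or_gt 0 n with h | h
    · positivity
    · exact mul_nonneg_of_nonpos_of_nonpos h.le (by omega)
  exact_mod_cast h

lemma thetaTerm_half_div (b : ℝ) (σ : ℂ) (n : ℤ) :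
    thetaTerm (1 / 2) b 0 σ n / cexp (π * I * σ / 4) =
      cexp (2 * π * I * (n + 1 / 2) * b) * cexp (π * I * ((n * (n + 1) : ℝ) : ℂ) * σ) := by
  rw [thetaTerm, ← Complex.exp_sub, ← Complex.exp_add]
  push_cast
  ring_nf

lemma tendsto_theta_half_zero {τ : ℂ} (hτ : 0 < τ.im) :
    Tendsto (fun k : ℕ => theta (1 / 2) 0 0 (2 ^ k * τ) / cexp (π * I * (2 ^ k * τ) / 4))
      atTop (𝓝 2) := by
  have h := tendsto_tsum_exp_two_pow_mul hτ (fun n => cexp (2 * π * I * (n + 1 / 2) * (0 : ℝ)))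
    (fun n => (n : ℝ) * (n + 1)) intCast_mul_add_one_nonneg
    (by simpa only [← thetaTerm_half_div] using (summable_thetaTerm (1 / 2) 0 0 hτ).div_const _)
  simp only [← thetaTerm_half_div, tsum_ite_mul_add_one, tsum_div_const] at h
  have h2 : cexp (2 * π * I * (((0 : ℤ) : ℂ) + 1 / 2) * ((0 : ℝ) : ℂ)) +
      cexp (2 * π * I * (((-1 : ℤ) : ℂ) + 1 / 2) * ((0 : ℝ) : ℂ)) = 2 := by
    norm_num
  rwa [h2] at h

lemma tendsto_deriv_theta_half_half {τ : ℂ} (hτ : 0 < τ.im) :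
    Tendsto (fun k : ℕ => deriv (fun z => theta (1 / 2) (1 / 2) z (2 ^ k * τ)) 0 /
      cexp (π * I * (2 ^ k * τ) / 4)) atTop (𝓝 (-2 * π)) := by
  have key : ∀ (σ : ℂ) (n : ℤ),
      2 * π * I * (n + (1 / 2 : ℝ)) * thetaTerm (1 / 2) (1 / 2) 0 σ n / cexp (π * I * σ / 4) =
      2 * π * I * (n + (1 / 2 : ℝ)) * cexp (2 * π * I * (n + 1 / 2) * (1 / 2 : ℝ)) *
        cexp (π * I * ((n * (n + 1) : ℝ) : ℂ) * σ) := by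
    intro σ n
    rw [mul_div_assoc, thetaTerm_half_div, ← mul_assoc]
  have h := tendsto_tsum_exp_two_pow_mul hτ
    (fun n => 2 * π * I * (n + (1 / 2 : ℝ)) * cexp (2 * π * I * (n + 1 / 2) * (1 / 2 : ℝ)))
    (fun n => (n : ℝ) * (n + 1)) intCast_mul_add_one_nonneg
    (by simpa only [← key] using (hasSum_deriv_theta (1 / 2) (1 / 2) 0 hτ).summable.div_const _)
  simp only [← key, tsum_ite_mul_add_one] at h
  convert h using 2 with k
  · exact ((hasSum_deriv_theta (1 / 2) (1 / 2) 0 (im_two_pow_mul_pos hτ k)).div_const _).tsum_eq.symm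
  · have e1 : cexp (2 * π * I * (((0 : ℤ) : ℂ) + 1 / 2) * ((1 / 2 : ℝ) : ℂ)) = I := by
      refine Eq.trans ?_ Complex.exp_pi_div_two_mul_I
      push_cast
      ring_nf
    have e2 : cexp (2 * π * I * (((-1 : ℤ) : ℂ) + 1 / 2) * ((1 / 2 : ℝ) : ℂ)) = -I := by
      refine Eq.trans ?_ Complex.exp_neg_pi_div_two_mul_I
      push_cast
      ring_nf
    rw [e1, e2]
    push_cast
    linear_combination (-2 * π : ℂ) * Complex.I_mul_I

/-- A property that descends from `2 * τ` to `τ` and holds eventually along `2 ^ k * τ`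
holds at `τ`. -/
lemma of_eventually_two_pow_mul {P : ℂ → Prop} {τ : ℂ} (hτ : 0 < τ.im)
    (hP : ∀ σ : ℂ, 0 < σ.im → P (2 * σ) → P σ) (h : ∀ᶠ k : ℕ in atTop, P (2 ^ k * τ)) :
    P τ := by
  obtain ⟨k, hk⟩ := h.exists
  induction k with
  | zero => simpa using hk
  | succ k ih =>
    refine ih (hP _ (im_two_pow_mul_pos hτ k) ?_)
    rwa [← mul_assoc, ← pow_succ']

lemma theta_zero_half_ne_zero {τ : ℂ} (hτ : 0 < τ.im) : theta 0 (1 / 2) 0 τ ≠ 0 := by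
  refine of_eventually_two_pow_mul (P := fun σ => theta 0 (1 / 2) 0 σ ≠ 0) hτ
    (fun σ hσ h => ?_) ((tendsto_theta_zero (1 / 2) hτ).eventually_ne one_ne_zero)
  exact right_ne_zero_of_mul (theta_zero_mul_theta_zero_half hσ ▸ pow_ne_zero 2 h)

lemma theta_zero_zero_ne_zero {τ : ℂ} (hτ : 0 < τ.im) : theta 0 0 0 τ ≠ 0 :=
  left_ne_zero_of_mul (theta_zero_mul_theta_zero_half hτ ▸
    pow_ne_zero 2 (theta_zero_half_ne_zero (im_two_mul_pos hτ)))

lemma theta_half_zero_ne_zero {τ : ℂ} (hτ : 0 < τ.im) : theta (1 / 2) 0 0 τ ≠ 0 := by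
  refine of_eventually_two_pow_mul (P := fun σ => theta (1 / 2) 0 0 σ ≠ 0) hτ
    (fun σ hσ h => ?_) (((tendsto_theta_half_zero hτ).eventually_ne two_ne_zero).mono
      fun k hk => (div_ne_zero_iff.mp hk).1)
  refine (pow_ne_zero_iff two_ne_zero).mp ?_
  rw [theta_half_zero_sq hσ]
  exact mul_ne_zero (mul_ne_zero two_ne_zero h) (theta_zero_zero_ne_zero (im_two_mul_pos hσ))

/-- The quotient of `θ_{1/2,1/2}'` by `θ_{0,0} * θ_{0,1/2} * θ_{1/2,0}` at the origin. -/
noncomputable def thetaRatio (τ : ℂ) : ℂ :=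
  deriv (fun z => theta (1 / 2) (1 / 2) z τ) 0 /
    (theta 0 0 0 τ * theta 0 (1 / 2) 0 τ * theta (1 / 2) 0 0 τ)

lemma thetaRatio_two_mul {τ : ℂ} (hτ : 0 < τ.im) : thetaRatio (2 * τ) = thetaRatio τ := by
  have h2 := im_two_mul_pos hτ
  have h3 := theta_zero_zero_ne_zero h2
  have h4 := theta_zero_half_ne_zero h2
  have h5 := theta_half_zero_ne_zero h2
  have h6 := theta_half_zero_ne_zero hτ
  have hd := deriv_theta_mul_theta_half_zero hτ
  have hs := theta_half_zero_sq hτ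
  rw [thetaRatio, thetaRatio, theta_zero_mul_theta_zero_half hτ, div_eq_div_iff
    (mul_ne_zero (mul_ne_zero h3 h4) h5) (mul_ne_zero (pow_ne_zero 2 h4) h6)]
  refine mul_right_cancel₀ (mul_ne_zero two_ne_zero h6) ?_
  linear_combination
    2 * deriv (fun z => theta (1 / 2) (1 / 2) z (2 * τ)) 0 * theta 0 (1 / 2) 0 (2 * τ) ^ 2 * hs -
    2 * theta 0 0 0 (2 * τ) * theta 0 (1 / 2) 0 (2 * τ) * theta (1 / 2) 0 0 (2 * τ) * hd

lemma thetaRatio_two_pow_mul {τ : ℂ} (hτ : 0 < τ.im) (k : ℕ) :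
    thetaRatio (2 ^ k * τ) = thetaRatio τ := by
  induction k with
  | zero => simp
  | succ k ih => rw [pow_succ', mul_assoc, thetaRatio_two_mul (im_two_pow_mul_pos hτ k), ih]

lemma thetaRatio_eq {τ : ℂ} (hτ : 0 < τ.im) : thetaRatio τ = -π := by
  have h := (tendsto_deriv_theta_half_half hτ).div
    (((tendsto_theta_zero 0 hτ).mul (tendsto_theta_zero (1 / 2) hτ)).mul
      (tendsto_theta_half_zero hτ)) (by norm_num)
  have hc : Tendsto (fun _ : ℕ => thetaRatio τ) atTop (𝓝 (-2 * π / (1 * 1 * 2))) := by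
    refine h.congr fun k => ?_
    rw [← thetaRatio_two_pow_mul hτ k, thetaRatio, Pi.div_apply, ← mul_div_assoc,
      div_div_div_cancel_right₀ (Complex.exp_ne_zero _)]
  rw [tendsto_nhds_unique tendsto_const_nhds hc]
  ring

/-- Jacobi's derivative formula. -/
theorem jacobi_derivative_formula (τ : ℂ) (hτ : 0 < τ.im) :
    deriv (fun z => theta (1/2) (1/2) z τ) 0 =
      -(Real.pi : ℂ) * theta 0 0 0 τ * theta 0 (1/2) 0 τ * theta (1/2) 0 0 τ := by
  have h := thetaRatio_eq hτ
  rw [thetaRatio, div_eq_iff (mul_ne_zero (mul_ne_zero (theta_zero_zero_ne_zero hτ)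
    (theta_zero_half_ne_zero hτ)) (theta_half_zero_ne_zero hτ))] at h
  rw [h]
  ring
end
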